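/- arXiv:1705.00134 — 4 statements merged into one kernel-verified Lean document; each statement's English description precedes it below -/
import Mathlib

section
/- Let d ≥ 1, let P be a finite partially ordered set on [d] = {1,...,d}, and let G be a perfect graph on [d]. Then the Ehrhart δ-polynomials satisfy δ(Ω(O_P, Q_G), λ) = δ(Ω(C_P, Q_G), λ). -/
open scoped Pointwise

namespace HibiTsuchiya

/-- A point of `ℝ^n` is a *lattice point* if all of its coordinates are integers. -/
def IsLatticePoint {n : ℕ} (x : Fin n → ℝ) : Prop := ∀ i, ∃ z : ℤ, x i = (z : ℝ)

/-- The dual polytope `P^∨ = {x : ⟨x,y⟩ ≤ 1 for all y ∈ P}`. -/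
def dualPolytope {n : ℕ} (P : Set (Fin n → ℝ)) : Set (Fin n → ℝ) :=
  {x | ∀ y ∈ P, ∑ i, x i * y i ≤ 1}

/-- A polytope `P ⊆ ℝ^n` is *reflexive* if the origin is an interior point of `P` and the
dual polytope of `P` is again a lattice polytope (i.e. the convex hull of finitely many
lattice points). -/
def IsReflexive {n : ℕ} (P : Set (Fin n → ℝ)) : Prop :=
  0 ∈ interior P ∧
    ∃ V : Finset (Fin n → ℝ), (∀ v ∈ V, IsLatticePoint v) ∧
      dualPolytope P = convexHull ℝ (V : Set (Fin n → ℝ))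

/-- `P` has the *integer decomposition property* if every lattice point of `m • P` (`m ≥ 1`)
is a sum of `m` lattice points of `P`. -/
def HasIDP {n : ℕ} (P : Set (Fin n → ℝ)) : Prop :=
  ∀ m : ℕ, 0 < m → ∀ a : Fin n → ℝ, IsLatticePoint a → a ∈ (m : ℝ) • P →
    ∃ f : Fin m → Fin n → ℝ, (∀ k, f k ∈ P ∧ IsLatticePoint (f k)) ∧ a = ∑ k, f k

/-- The indicator vector `ρ(S) = ∑_{j ∈ S} e_j` of a subset `S ⊆ [n]`. -/
noncomputable def indicator {n : ℕ} (S : Set (Fin n)) : Fin n → ℝ :=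
  S.indicator (fun _ => (1 : ℝ))

/-- A poset ideal of a partial order `P` on `[n]`. -/
def IsPosetIdeal {n : ℕ} (P : PartialOrder (Fin n)) (I : Set (Fin n)) : Prop :=
  ∀ i ∈ I, ∀ j, P.le j i → j ∈ I

/-- The order polytope `O_P`: the convex hull of the indicator vectors of poset ideals. -/
noncomputable def orderPolytope {n : ℕ} (P : PartialOrder (Fin n)) : Set (Fin n → ℝ) :=
  convexHull ℝ {x | ∃ I : Set (Fin n), IsPosetIdeal P I ∧ x = indicator I}

/-- An antichain of a partial order `P` on `[n]`: a pairwise incomparable subset. -/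
def IsPosetAntichain {n : ℕ} (P : PartialOrder (Fin n)) (A : Set (Fin n)) : Prop :=
  ∀ i ∈ A, ∀ j ∈ A, i ≠ j → ¬ P.le i j ∧ ¬ P.le j i

/-- The chain polytope `C_P`: the convex hull of the indicator vectors of antichains. -/
noncomputable def chainPolytope {n : ℕ} (P : PartialOrder (Fin n)) : Set (Fin n → ℝ) :=
  convexHull ℝ {x | ∃ A : Set (Fin n), IsPosetAntichain P A ∧ x = indicator A}

/-- A stable (independent) set of a graph. -/
def IsStableSet {V : Type*} (G : SimpleGraph V) (S : Set V) : Prop :=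
  ∀ i ∈ S, ∀ j ∈ S, ¬ G.Adj i j

/-- The stable set polytope `Q_G`: the convex hull of the indicator vectors of stable sets. -/
noncomputable def stableSetPolytope {n : ℕ} (G : SimpleGraph (Fin n)) : Set (Fin n → ℝ) :=
  convexHull ℝ {x | ∃ S : Set (Fin n), IsStableSet G S ∧ x = indicator S}

/-- The clique number of a graph, as an extended natural number. -/
noncomputable def cliqueNumber {V : Type*} (G : SimpleGraph V) : ℕ∞ :=
  ⨆ (t : Finset V) (_ : G.IsClique (t : Set V)), (t.card : ℕ∞)

/-- A graph is *perfect* if for every induced subgraph (including the graph itself)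
the chromatic number equals the clique number. -/
def IsPerfectGraph {V : Type*} (G : SimpleGraph V) : Prop :=
  ∀ s : Set V, (G.induce s).chromaticNumber = cliqueNumber (G.induce s)

/-- A simplicial complex on the vertex set `[n]`. -/
def IsSimplicialComplex {n : ℕ} (Δ : Set (Finset (Fin n))) : Prop :=
  (∀ i : Fin n, {i} ∈ Δ) ∧ ∀ F ∈ Δ, ∀ F' ⊆ F, F' ∈ Δ

/-- The polytope `P_Δ`: the convex hull of the indicator vectors of the faces of `Δ`. -/
noncomputable def complexPolytope {n : ℕ} (Δ : Set (Finset (Fin n))) : Set (Fin n → ℝ) :=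
  convexHull ℝ {x | ∃ F ∈ Δ, x = indicator (↑F : Set (Fin n))}

/-- `Γ(P,Q) = conv(P ∪ (−Q))`. -/
noncomputable def gammaPolytope {n : ℕ} (P Q : Set (Fin n → ℝ)) : Set (Fin n → ℝ) :=
  convexHull ℝ (P ∪ -Q)

/-- `Ω(P,Q) = conv((P × {1}) ∪ ((−Q) × {−1})) ⊆ ℝ^{n+1}`. -/
noncomputable def omegaPolytope {n : ℕ} (P Q : Set (Fin n → ℝ)) : Set (Fin (n+1) → ℝ) :=
  convexHull ℝ
    ((fun x : Fin n → ℝ => Fin.snoc x (1 : ℝ)) '' P ∪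
     (fun x : Fin n → ℝ => Fin.snoc x (-1 : ℝ)) '' (-Q))

/-- The number of lattice points of a set `P ⊆ ℝ^n`. -/
noncomputable def latticePointCount {n : ℕ} (P : Set (Fin n → ℝ)) : ℕ :=
  Set.ncard {x | x ∈ P ∧ IsLatticePoint x}

/-- The Ehrhart series `1 + ∑_{m ≥ 1} |mP ∩ ℤ^n| λ^m` of `P ⊆ ℝ^n`. -/
noncomputable def ehrhartSeries {n : ℕ} (P : Set (Fin n → ℝ)) : PowerSeries ℚ :=
  PowerSeries.mk fun m => if m = 0 then 1 else (latticePointCount ((m : ℝ) • P) : ℚ)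

/-- The Ehrhart `δ`-polynomial `δ(P,λ) = (1-λ)^{n+1} (1 + ∑_{m ≥ 1} |mP ∩ ℤ^n| λ^m)`
of a polytope `P ⊆ ℝ^n`, encoded as a formal power series. -/
noncomputable def deltaPolynomial {n : ℕ} (P : Set (Fin n → ℝ)) : PowerSeries ℚ :=
  (1 - PowerSeries.X) ^ (n + 1) * ehrhartSeries P

/-! ### The transfer map -/

section Transfer

variable {n : ℕ}

open Classical in
/-- `upMax P x i = max (0, max_{j > i} x j)`. -/
noncomputable def upMax (P : PartialOrder (Fin n)) (x : Fin n → ℝ) (i : Fin n) : ℝ :=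
  (((Finset.univ.filter (fun j => P.lt i j)).sup (fun j => Real.toNNReal (x j)) : NNReal) : ℝ)

lemma upMax_nonneg (P : PartialOrder (Fin n)) (x : Fin n → ℝ) (i : Fin n) :
    0 ≤ upMax P x i := NNReal.coe_nonneg _

lemma le_upMax (P : PartialOrder (Fin n)) (x : Fin n → ℝ) {i j : Fin n} (h : P.lt i j) :
    x j ≤ upMax P x i := by
  classical
  unfold upMax
  have h1 : Real.toNNReal (x j) ≤
      (Finset.univ.filter (fun j => P.lt i j)).sup (fun j => Real.toNNReal (x j)) :=
    Finset.le_sup (f := fun j => Real.toNNReal (x j)) (by simpa using h)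
  exact (Real.le_coe_toNNReal (x j)).trans (by convert NNReal.coe_le_coe.2 h1)

lemma upMax_le (P : PartialOrder (Fin n)) (x : Fin n → ℝ) {i : Fin n} {c : ℝ} (hc : 0 ≤ c)
    (h : ∀ j, P.lt i j → x j ≤ c) : upMax P x i ≤ c := by
  classical
  unfold upMax
  have h1 : (Finset.univ.filter (fun j => P.lt i j)).sup (fun j => Real.toNNReal (x j)) ≤
      Real.toNNReal c := by
    apply Finset.sup_le
    intro j hj
    exact Real.toNNReal_le_toNNReal (h j (by simpa using hj))
  have h2 := NNReal.coe_le_coe.2 h1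
  rw [Real.coe_toNNReal c hc] at h2
  convert h2

lemma upMax_attained (P : PartialOrder (Fin n)) (x : Fin n → ℝ) (i : Fin n) :
    upMax P x i = 0 ∨ ∃ j, P.lt i j ∧ upMax P x i = x j := by
  classical
  by_contra hcon
  push Not at hcon
  obtain ⟨h0, h1⟩ := hcon
  have hpos : 0 < upMax P x i := lt_of_le_of_ne (upMax_nonneg P x i) (Ne.symm h0)
  let s : Finset ℝ := insert 0 ((Finset.univ.filter (fun j => P.lt i j)).image x)
  have hs : s.Nonempty := ⟨0, by simp [s]⟩
  have hle : upMax P x i ≤ s.max' hs := by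
    apply upMax_le
    · exact Finset.le_max' _ _ (by simp [s])
    · intro j hj
      exact Finset.le_max' _ _ (by
        simp only [s, Finset.mem_insert, Finset.mem_image, Finset.mem_filter, Finset.mem_univ,
          true_and]
        exact Or.inr ⟨j, hj, rfl⟩)
  have hmem := Finset.max'_mem s hs
  have hm2 : s.max' hs = 0 ∨ ∃ j, P.lt i j ∧ x j = s.max' hs := by
    have := hmem
    simp only [s, Finset.mem_insert, Finset.mem_image, Finset.mem_filter, Finset.mem_univ,
          true_and] at this
    exact this
  rcases hm2 with h | ⟨j, hj, h⟩
  · linarith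
  · have := le_upMax P x hj
    exact h1 j hj (by linarith)

lemma upMax_congr (P : PartialOrder (Fin n)) {x y : Fin n → ℝ} {i : Fin n}
    (h : ∀ j, P.lt i j → x j = y j) : upMax P x i = upMax P y i := by
  apply le_antisymm
  · exact upMax_le P x (upMax_nonneg _ _ _) fun j hj => (h j hj).le.trans (le_upMax P y hj)
  · exact upMax_le P y (upMax_nonneg _ _ _) fun j hj => (h j hj).ge.trans (le_upMax P x hj)

/-- The (extended) transfer map. -/
noncomputable def transfer (P : PartialOrder (Fin n)) (x : Fin n → ℝ) : Fin n → ℝ :=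
  fun i => x i - upMax P x i

lemma gt_wf (P : PartialOrder (Fin n)) : WellFounded (fun j i : Fin n => P.lt i j) := by
  have : Std.Irrefl (fun j i : Fin n => P.lt i j) := ⟨fun a h => @_root_.lt_irrefl _ P.toPreorder a h⟩
  have : IsTrans (Fin n) (fun j i : Fin n => P.lt i j) :=
    ⟨fun a b c h h' => @_root_.lt_trans _ P.toPreorder c b a h' h⟩
  exact Finite.wellFounded_of_trans_of_irrefl _

lemma transfer_injective (P : PartialOrder (Fin n)) : Function.Injective (transfer P) := by
  intro x y hxy
  funext i
  induction i using (gt_wf P).induction with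
  | _ i ih =>
    have h1 := congrFun hxy i
    simp only [transfer] at h1
    have h2 := upMax_congr P (x := x) (y := y) (i := i) ih
    linarith

lemma transfer_surjective (P : PartialOrder (Fin n)) : Function.Surjective (transfer P) := by
  classical
  intro z
  let F : ∀ i : Fin n, (∀ j, P.lt i j → ℝ) → ℝ := fun i r =>
    z i + upMax P (fun j => if h : P.lt i j then r j h else 0) i
  let x : Fin n → ℝ := (gt_wf P).fix F
  refine ⟨x, ?_⟩
  funext i
  have h1 : x i = F i (fun j _ => x j) := (gt_wf P).fix_eq F i
  have h2 : upMax P (fun j => if h : P.lt i j then x j else 0) i = upMax P x i :=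
    upMax_congr P (fun j hj => by simp [hj])
  have h3 : F i (fun j _ => x j) = z i + upMax P x i := by
    simp only [F]
    rw [← h2]
  simp only [transfer]
  linarith

lemma upMax_int (P : PartialOrder (Fin n)) {x : Fin n → ℝ} {i : Fin n}
    (h : ∀ j, P.lt i j → ∃ z : ℤ, x j = z) : ∃ z : ℤ, upMax P x i = z := by
  rcases upMax_attained P x i with h0 | ⟨j, hj, h0⟩
  · exact ⟨0, by simp [h0]⟩
  · obtain ⟨z, hz⟩ := h j hj
    exact ⟨z, by rw [h0, hz]⟩

lemma transfer_lattice (P : PartialOrder (Fin n)) (x : Fin n → ℝ) :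
    IsLatticePoint (transfer P x) ↔ IsLatticePoint x := by
  constructor
  · intro h i
    induction i using (gt_wf P).induction with
    | _ i ih =>
      obtain ⟨z, hz⟩ := h i
      obtain ⟨w, hw⟩ := upMax_int P (x := x) (i := i) ih
      refine ⟨z + w, ?_⟩
      simp only [transfer] at hz
      push_cast
      linarith
  · intro h i
    obtain ⟨z, hz⟩ := h i
    obtain ⟨w, hw⟩ := upMax_int P (x := x) (i := i) (fun j _ => h j)
    exact ⟨z - w, by simp [transfer, hz, hw]⟩

/-- The smallest nonnegative order-reversing function above `x`. -/
noncomputable def hull (P : PartialOrder (Fin n)) (x : Fin n → ℝ) : Fin n → ℝ :=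
  fun i => max (x i) (upMax P x i)

lemma hull_nonneg (P : PartialOrder (Fin n)) (x : Fin n → ℝ) (i : Fin n) : 0 ≤ hull P x i :=
  (upMax_nonneg P x i).trans (le_max_right _ _)

lemma hull_le_upMax (P : PartialOrder (Fin n)) (x : Fin n → ℝ) {i j : Fin n} (h : P.lt i j) :
    hull P x j ≤ upMax P x i :=
  max_le (le_upMax P x h)
    (upMax_le P x (upMax_nonneg _ _ _) fun k hk => le_upMax P x (@_root_.lt_trans _ P.toPreorder i j k h hk))

lemma upMax_hull (P : PartialOrder (Fin n)) (x : Fin n → ℝ) (i : Fin n) :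
    upMax P (hull P x) i = upMax P x i := by
  apply le_antisymm
  · exact upMax_le P _ (upMax_nonneg _ _ _) fun j hj => hull_le_upMax P x hj
  · exact upMax_le P _ (upMax_nonneg _ _ _) fun j hj =>
      (le_max_left _ _).trans (le_upMax P (hull P x) hj)

lemma P_lt_of (P : PartialOrder (Fin n)) {i j : Fin n} (h : P.le i j) (hne : i ≠ j) :
    P.lt i j := by
  rw [P.lt_iff_le_not_ge]
  exact ⟨h, fun h' => hne (P.le_antisymm _ _ h h')⟩

lemma P_le_of (P : PartialOrder (Fin n)) {i j : Fin n} (h : P.lt i j) : P.le i j :=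
  ((P.lt_iff_le_not_ge i j).1 h).1

lemma hull_anti (P : PartialOrder (Fin n)) (x : Fin n → ℝ) {i j : Fin n} (h : P.le i j) :
    hull P x j ≤ hull P x i := by
  by_cases hij : i = j
  · rw [hij]
  · exact (hull_le_upMax P x (P_lt_of P h hij)).trans (le_max_right _ _)

lemma hull_le (P : PartialOrder (Fin n)) {x p : Fin n → ℝ} (hp0 : ∀ i, 0 ≤ p i)
    (hp : ∀ i j, P.le i j → p j ≤ p i) (hx : ∀ i, x i ≤ p i) (i : Fin n) : hull P x i ≤ p i :=
  max_le (hx i) (upMax_le P x (hp0 i) fun j hj => (hx j).trans (hp i j (P_le_of P hj)))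

lemma transfer_hull (P : PartialOrder (Fin n)) (x : Fin n → ℝ) (i : Fin n) :
    transfer P (hull P x) i = max (transfer P x i) 0 := by
  simp only [transfer, upMax_hull, hull]
  rcases le_total (x i) (upMax P x i) with h | h
  · rw [max_eq_right h, max_eq_right (by linarith)]; ring
  · rw [max_eq_left h, max_eq_left (by linarith)]

lemma hull_sub (P : PartialOrder (Fin n)) (x : Fin n → ℝ) (i : Fin n) :
    hull P x i - x i = max (-transfer P x i) 0 := by
  simp only [transfer, hull]
  rcases le_total (x i) (upMax P x i) with h | h
  · rw [max_eq_right h, max_eq_left (by linarith)]; ring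
  · rw [max_eq_left h, max_eq_right (by linarith)]; ring

/-! ### Layer decomposition -/

lemma indicator_of_mem {S : Set (Fin n)} {i : Fin n} (h : i ∈ S) : indicator S i = 1 := by
  simp [indicator, h]

lemma indicator_of_notMem {S : Set (Fin n)} {i : Fin n} (h : i ∉ S) : indicator S i = 0 := by
  simp [indicator, h]

lemma indicator_empty : indicator (∅ : Set (Fin n)) = 0 := by
  funext i; simp [indicator]

lemma indicator_nonneg' (S : Set (Fin n)) (i : Fin n) : 0 ≤ indicator S i := by
  by_cases h : i ∈ S
  · rw [indicator_of_mem h]; norm_num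
  · rw [indicator_of_notMem h]

lemma indicator_le_one' (S : Set (Fin n)) (i : Fin n) : indicator S i ≤ 1 := by
  by_cases h : i ∈ S
  · rw [indicator_of_mem h]
  · rw [indicator_of_notMem h]; norm_num

lemma order_gen (P : PartialOrder (Fin n)) {I : Set (Fin n)} (h : IsPosetIdeal P I) :
    indicator I ∈ orderPolytope P := subset_convexHull ℝ _ ⟨I, h, rfl⟩

lemma chain_gen (P : PartialOrder (Fin n)) {I : Set (Fin n)} (h : IsPosetAntichain P I) :
    indicator I ∈ chainPolytope P := subset_convexHull ℝ _ ⟨I, h, rfl⟩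

lemma stable_gen (G : SimpleGraph (Fin n)) {I : Set (Fin n)} (h : IsStableSet G I) :
    indicator I ∈ stableSetPolytope G := subset_convexHull ℝ _ ⟨I, h, rfl⟩

lemma convex_order (P : PartialOrder (Fin n)) : Convex ℝ (orderPolytope P) :=
  convex_convexHull ℝ _

lemma convex_chain (P : PartialOrder (Fin n)) : Convex ℝ (chainPolytope P) :=
  convex_convexHull ℝ _

lemma convex_stable (G : SimpleGraph (Fin n)) : Convex ℝ (stableSetPolytope G) :=
  convex_convexHull ℝ _

lemma layer (P : PartialOrder (Fin n)) (k : ℕ) : ∀ (y : Fin n → ℝ) (a : ℝ),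
    {i | y i ≠ 0}.ncard ≤ k → 0 ≤ a → (∀ i, 0 ≤ y i) → (∀ i, y i ≤ a) →
    (∀ i j, P.le i j → y j ≤ y i) →
    y ∈ a • orderPolytope P ∧ transfer P y ∈ a • chainPolytope P := by
  have hzero : ∀ a : ℝ, (0 : Fin n → ℝ) ∈ a • orderPolytope P ∧
      transfer P 0 ∈ a • chainPolytope P := by
    intro a
    constructor
    · refine ⟨indicator ∅, order_gen P (fun i hi => hi.elim), ?_⟩
      simp [indicator_empty]
    · refine ⟨indicator ∅, chain_gen P (fun i hi => hi.elim), ?_⟩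
      funext i
      have h1 : upMax P (0 : Fin n → ℝ) i = 0 :=
        le_antisymm (upMax_le P _ le_rfl fun j _ => le_rfl) (upMax_nonneg _ _ _)
      simp [indicator_empty, transfer, h1]
  induction k with
  | zero =>
    intro y a hk ha h0 h1 hanti
    have : {i | y i ≠ 0} = ∅ := by
      rw [← Set.ncard_eq_zero (Set.toFinite _)]; omega
    have hy : y = 0 := by
      funext i
      by_contra h
      have : i ∈ {i | y i ≠ 0} := h
      simp_all
    rw [hy]; exact hzero a
  | succ k ih =>
    intro y a hk ha h0 h1 hanti
    by_cases hy : y = 0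
    · rw [hy]; exact hzero a
    obtain ⟨i0, hi0⟩ : ∃ i, y i ≠ 0 := by
      by_contra h
      push Not at h
      exact hy (funext h)
    obtain ⟨m, hm, hmin⟩ := Set.exists_min_image {i | y i ≠ 0} y (Set.toFinite _) ⟨i0, hi0⟩
    set I : Set (Fin n) := {i | y i ≠ 0} with hI
    have hm' : y m ≠ 0 := hm
    have hcpos : 0 < y m := lt_of_le_of_ne (h0 m) (Ne.symm hm')
    set c := y m with hc
    have hideal : IsPosetIdeal P I := by
      intro i hi j hji
      have hi' : y i ≠ 0 := hi
      have h2 : 0 < y i := lt_of_le_of_ne (h0 i) (Ne.symm hi')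
      have := hanti j i hji
      show y j ≠ 0
      exact (lt_of_lt_of_le h2 this).ne'
    set A : Set (Fin n) := {i | i ∈ I ∧ ∀ j, P.lt i j → j ∉ I} with hA
    have hAanti : IsPosetAntichain P A := by
      intro i hi j hj hij
      exact ⟨fun h => hi.2 j (P_lt_of P h hij) hj.1, fun h => hj.2 i (P_lt_of P h hij.symm) hi.1⟩
    set y' : Fin n → ℝ := fun i => y i - c * indicator I i with hy'
    have hy'in : ∀ i ∈ I, y' i = y i - c := fun i hi => by simp [hy', indicator_of_mem hi]
    have hyout : ∀ i, i ∉ I → y i = 0 := fun i hi => by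
      by_contra h; exact hi h
    have hy'out : ∀ i, i ∉ I → y' i = 0 := fun i hi => by
      simp [hy', indicator_of_notMem hi, hyout i hi]
    have h0' : ∀ i, 0 ≤ y' i := by
      intro i
      by_cases hi : i ∈ I
      · rw [hy'in i hi]; linarith [hmin i hi]
      · rw [hy'out i hi]
    have hca : c ≤ a := h1 m
    have h1' : ∀ i, y' i ≤ a - c := by
      intro i
      by_cases hi : i ∈ I
      · rw [hy'in i hi]; linarith [h1 i]
      · rw [hy'out i hi]; linarith
    have hanti' : ∀ i j, P.le i j → y' j ≤ y' i := by
      intro i j hij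
      by_cases hj : j ∈ I
      · rw [hy'in j hj, hy'in i (hideal j hj i hij)]; linarith [hanti i j hij]
      · rw [hy'out j hj]; exact h0' i
    have hcard : {i | y' i ≠ 0}.ncard ≤ k := by
      have hss : {i | y' i ≠ 0} ⊂ I := by
        refine ⟨fun i hi => ?_, fun hsub => ?_⟩
        · by_contra h; exact hi (hy'out i h)
        · exact hsub hm (by rw [hy'in m hm]; simp [hc])
      have := Set.ncard_lt_ncard hss (Set.toFinite _)
      omega
    obtain ⟨ho, hch⟩ := ih y' (a - c) hcard (by linarith) h0' h1' hanti'
    have hupin : ∀ i, (∃ j, P.lt i j ∧ j ∈ I) → upMax P y i = upMax P y' i + c := by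
      rintro i ⟨j, hij, hj⟩
      apply le_antisymm
      · apply upMax_le P _ (add_nonneg (upMax_nonneg _ _ _) hcpos.le)
        intro l hl
        by_cases hlI : l ∈ I
        · have := le_upMax P y' hl
          rw [hy'in l hlI] at this; linarith
        · rw [hyout l hlI]; exact add_nonneg (upMax_nonneg _ _ _) hcpos.le
      · have hcle : c ≤ upMax P y i := (hmin j hj).trans (le_upMax P y hij)
        have : upMax P y' i ≤ upMax P y i - c := by
          apply upMax_le P _ (by linarith)
          intro l hl
          by_cases hlI : l ∈ I
          · rw [hy'in l hlI]; linarith [le_upMax P y hl]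
          · rw [hy'out l hlI]; linarith
        linarith
    have hupout : ∀ i, (¬ ∃ j, P.lt i j ∧ j ∈ I) → upMax P y i = upMax P y' i := by
      intro i hi
      push Not at hi
      exact upMax_congr P fun j hj => by rw [hyout j (hi j hj), hy'out j (hi j hj)]
    have hsplit : a = (a - c) + c := by ring
    have hac : 0 ≤ a - c := by linarith
    constructor
    · rw [hsplit, (convex_order P).add_smul hac hcpos.le]
      refine ⟨y', ho, c • indicator I, ⟨_, order_gen P hideal, rfl⟩, ?_⟩
      funext i
      simp [hy']
    · rw [hsplit, (convex_chain P).add_smul hac hcpos.le]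
      refine ⟨_, hch, c • indicator A, ⟨_, chain_gen P hAanti, rfl⟩, ?_⟩
      funext i
      simp only [Pi.add_apply, Pi.smul_apply, smul_eq_mul, transfer]
      by_cases hi : i ∈ I
      · rw [hy'in i hi]
        by_cases hex : ∃ j, P.lt i j ∧ j ∈ I
        · have hiA : i ∉ A := by
            obtain ⟨j, hj, hjI⟩ := hex
            exact fun h => h.2 j hj hjI
          rw [hupin i hex, indicator_of_notMem hiA]; ring
        · have hiA : i ∈ A := ⟨hi, fun j hj hjI => hex ⟨j, hj, hjI⟩⟩
          rw [hupout i hex, indicator_of_mem hiA]; ring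
      · have hex : ¬ ∃ j, P.lt i j ∧ j ∈ I := by
          rintro ⟨j, hj, hjI⟩
          exact hi (hideal j hjI i (P_le_of P hj))
        have hiA : i ∉ A := fun h => hi h.1
        rw [hy'out i hi, hyout i hi, hupout i hex, indicator_of_notMem hiA]; ring

/-! ### Anti-blocking property -/

/-- Closed under decreasing coordinates while staying nonnegative. -/
def AntiBlocking (A : Set (Fin n → ℝ)) : Prop :=
  ∀ u v : Fin n → ℝ, (∀ i, 0 ≤ u i) → (∀ i, u i ≤ v i) → v ∈ A → u ∈ A

lemma antiBlocking_smul {A : Set (Fin n → ℝ)} (hA : AntiBlocking A) {b : ℝ} (hb : 0 ≤ b) :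
    AntiBlocking (b • A) := by
  rintro u v h0 huv ⟨w, hw, rfl⟩
  rcases hb.eq_or_lt with rfl | hb
  · refine ⟨w, hw, ?_⟩
    funext i
    have h1 := huv i
    have h2 := h0 i
    simp only [zero_smul, Pi.zero_apply] at h1 ⊢
    linarith
  · refine ⟨b⁻¹ • u, hA _ w ?_ ?_ hw, ?_⟩
    · intro i
      exact mul_nonneg (inv_nonneg.2 hb.le) (h0 i)
    · intro i
      have h1 := huv i
      simp only [Pi.smul_apply, smul_eq_mul] at h1 ⊢
      rw [inv_mul_le_iff₀ hb]
      exact h1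
    · simp [smul_smul, hb.ne']

lemma antiBlocking_hull (F : Set (Fin n) → Prop) (hF : ∀ S T, S ⊆ T → F T → F S) :
    AntiBlocking (convexHull ℝ {x | ∃ S : Set (Fin n), F S ∧ x = indicator S}) := by
  classical
  set A := convexHull ℝ {x | ∃ S : Set (Fin n), F S ∧ x = indicator S} with hA
  have hconv : Convex ℝ A := convex_convexHull ℝ _
  have hzero : ∀ (i : Fin n) (v : Fin n → ℝ), v ∈ A → Function.update v i 0 ∈ A := by
    intro i v hv
    let L : (Fin n → ℝ) →ₗ[ℝ] (Fin n → ℝ) :=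
      { toFun := fun v => Function.update v i 0
        map_add' := by
          intro x y; funext j
          by_cases h : j = i
          · subst h; simp
          · simp [Function.update_of_ne h]
        map_smul' := by
          intro c x; funext j
          by_cases h : j = i
          · subst h; simp
          · simp [Function.update_of_ne h] }
    have hsub : A ⊆ L ⁻¹' A := by
      apply convexHull_min
      · rintro _ ⟨S, hS, rfl⟩
        apply subset_convexHull ℝ _
        refine ⟨S \ {i}, hF _ S Set.sdiff_subset hS, ?_⟩
        funext j
        show Function.update (indicator S) i 0 j = _
        by_cases h : j = i
        · subst h; simp [indicator]
        · rw [Function.update_of_ne h]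
          by_cases hj : j ∈ S
          · rw [indicator_of_mem hj, indicator_of_mem (by exact ⟨hj, h⟩)]
          · rw [indicator_of_notMem hj, indicator_of_notMem (by exact fun h' => hj h'.1)]
      · exact hconv.linear_preimage L
    exact hsub hv
  have hone : ∀ (i : Fin n) (v : Fin n → ℝ) (t : ℝ), v ∈ A → 0 ≤ t → t ≤ v i →
      Function.update v i t ∈ A := by
    intro i v t hv ht htv
    rcases (ht.trans htv).eq_or_lt with h | h
    · have : t = 0 := by linarith
      rw [this]; exact hzero i v hv
    · have := hconv hv (hzero i v hv) (a := t / v i) (b := 1 - t / v i) (by positivity)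
        (by rw [sub_nonneg, div_le_one h]; exact htv) (by ring)
      convert this using 1
      funext j
      by_cases hj : j = i
      · subst hj
        simp [h.ne']
      · simp [Function.update_of_ne hj]; ring
  intro u v h0 huv hv
  have key : ∀ s : Finset (Fin n), s.piecewise u v ∈ A := by
    intro s
    induction s using Finset.induction_on with
    | empty => simpa using hv
    | insert i s hi ih =>
      rw [Finset.piecewise_insert]
      apply hone i _ _ ih (h0 i)
      rw [Finset.piecewise_eq_of_notMem _ _ _ hi]
      exact huv i
  simpa using key Finset.univ

lemma antiBlocking_chain (P : PartialOrder (Fin n)) : AntiBlocking (chainPolytope P) :=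
  antiBlocking_hull (IsPosetAntichain P) fun _ _ hST hT i hi j hj =>
    hT i (hST hi) j (hST hj)

lemma antiBlocking_stable (G : SimpleGraph (Fin n)) : AntiBlocking (stableSetPolytope G) :=
  antiBlocking_hull (IsStableSet G) fun _ _ hST hT i hi j hj =>
    hT i (hST hi) j (hST hj)

lemma hull_set_nonneg (F : Set (Fin n) → Prop) {v : Fin n → ℝ}
    (hv : v ∈ convexHull ℝ {x | ∃ S : Set (Fin n), F S ∧ x = indicator S}) (i : Fin n) :
    0 ≤ v i := by
  have hsub : convexHull ℝ {x | ∃ S : Set (Fin n), F S ∧ x = indicator S} ⊆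
      {v : Fin n → ℝ | 0 ≤ v i} := by
    apply convexHull_min
    · rintro _ ⟨S, _, rfl⟩
      exact indicator_nonneg' S i
    · intro x hx y hy a b ha hb _
      exact add_nonneg (mul_nonneg ha hx) (mul_nonneg hb hy)
  exact hsub hv

lemma order_ineq (P : PartialOrder (Fin n)) {v : Fin n → ℝ} (hv : v ∈ orderPolytope P) :
    (∀ i, v i ≤ 1) ∧ ∀ i j, P.le i j → v j ≤ v i := by
  have hsub : orderPolytope P ⊆
      {v : Fin n → ℝ | (∀ i, v i ≤ 1) ∧ ∀ i j, P.le i j → v j ≤ v i} := by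
    apply convexHull_min
    · rintro _ ⟨S, hS, rfl⟩
      refine ⟨indicator_le_one' S, fun i j hij => ?_⟩
      by_cases hj : j ∈ S
      · rw [indicator_of_mem hj, indicator_of_mem (hS j hj i hij)]
      · rw [indicator_of_notMem hj]; exact indicator_nonneg' S i
    · rintro x ⟨hx1, hx2⟩ y ⟨hy1, hy2⟩ a b ha hb hab
      constructor
      · intro i
        simp only [Pi.add_apply, Pi.smul_apply, smul_eq_mul]
        nlinarith [mul_le_mul_of_nonneg_left (hx1 i) ha, mul_le_mul_of_nonneg_left (hy1 i) hb]
      · intro i j hij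
        simp only [Pi.add_apply, Pi.smul_apply, smul_eq_mul]
        exact add_le_add (mul_le_mul_of_nonneg_left (hx2 i j hij) ha)
          (mul_le_mul_of_nonneg_left (hy2 i j hij) hb)
  exact hsub hv

lemma chain_ineq (P : PartialOrder (Fin n)) {v : Fin n → ℝ} (hv : v ∈ chainPolytope P)
    (c : Finset (Fin n)) (hc : ∀ i ∈ c, ∀ j ∈ c, P.le i j ∨ P.le j i) : ∑ i ∈ c, v i ≤ 1 := by
  classical
  have hsub : chainPolytope P ⊆ {v : Fin n → ℝ | ∑ i ∈ c, v i ≤ 1} := by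
    apply convexHull_min
    · rintro _ ⟨S, hS, rfl⟩
      show ∑ i ∈ c, indicator S i ≤ 1
      by_cases hex : ∃ i ∈ c, i ∈ S
      · obtain ⟨i, hic, hiS⟩ := hex
        rw [Finset.sum_eq_single_of_mem i hic]
        · exact indicator_le_one' S i
        · intro j hj hji
          apply indicator_of_notMem
          intro hjS
          have h1 := hS i hiS j hjS hji.symm
          rcases hc i hic j hj with h | h
          · exact h1.1 h
          · exact h1.2 h
      · push Not at hex
        rw [Finset.sum_eq_zero fun i hi => indicator_of_notMem (hex i hi)]
        norm_num
    · intro x hx y hy a b ha hb hab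
      have hx' : ∑ i ∈ c, x i ≤ 1 := hx
      have hy' : ∑ i ∈ c, y i ≤ 1 := hy
      show ∑ i ∈ c, (a • x + b • y) i ≤ 1
      simp only [Pi.add_apply, Pi.smul_apply, smul_eq_mul, Finset.sum_add_distrib,
        ← Finset.mul_sum]
      nlinarith [mul_le_mul_of_nonneg_left hx' ha, mul_le_mul_of_nonneg_left hy' hb]
  exact hsub hv

lemma exists_chain (P : PartialOrder (Fin n)) (x : Fin n → ℝ) (i : Fin n) :
    ∃ c : Finset (Fin n), (∀ j ∈ c, P.le i j) ∧ (∀ j ∈ c, ∀ k ∈ c, P.le j k ∨ P.le k j) ∧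
      hull P x i ≤ ∑ j ∈ c, max (transfer P x j) 0 := by
  classical
  induction i using (gt_wf P).induction with
  | _ i ih =>
    have hval : hull P x i = max (transfer P x i) 0 + upMax P (hull P x) i := by
      rw [← transfer_hull]; simp [transfer]
    rcases upMax_attained P (hull P x) i with h0 | ⟨j, hij, h0⟩
    · refine ⟨{i}, ?_, ?_, ?_⟩
      · intro j hj
        rw [Finset.mem_singleton.1 hj]
      · intro j hj k hk
        rw [Finset.mem_singleton.1 hj, Finset.mem_singleton.1 hk]; exact Or.inl (P.le_refl i)
      · rw [hval, h0]; simp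
    · obtain ⟨c, hc1, hc2, hc3⟩ := ih j hij
      have hic : i ∉ c := fun h => by
        have h1 := hc1 i h
        exact ((P.lt_iff_le_not_ge i j).1 hij).2 h1
      have hle : ∀ k ∈ c, P.le i k := fun k hk => P.le_trans _ _ _ (P_le_of P hij) (hc1 k hk)
      refine ⟨insert i c, ?_, ?_, ?_⟩
      · intro k hk
        rcases Finset.mem_insert.1 hk with rfl | hk
        · exact P.le_refl _
        · exact hle k hk
      · intro k hk l hl
        rcases Finset.mem_insert.1 hk with hk' | hk'
        · rcases Finset.mem_insert.1 hl with hl' | hl'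
          · rw [hk', hl']; exact Or.inl (P.le_refl _)
          · rw [hk']; exact Or.inl (hle l hl')
        · rcases Finset.mem_insert.1 hl with hl' | hl'
          · rw [hl']; exact Or.inr (hle k hk')
          · exact hc2 k hk' l hl'
      · rw [Finset.sum_insert hic, hval, h0]
        linarith

/-! ### The key equivalence -/

lemma key_iff (P : PartialOrder (Fin n)) (G : SimpleGraph (Fin n)) {a b : ℝ} (ha : 0 ≤ a)
    (hb : 0 ≤ b) (x : Fin n → ℝ) :
    (∃ p ∈ orderPolytope P, ∃ q ∈ stableSetPolytope G, x = a • p - b • q) ↔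
    (∃ p ∈ chainPolytope P, ∃ q ∈ stableSetPolytope G, transfer P x = a • p - b • q) := by
  have hAB := antiBlocking_smul (antiBlocking_stable G) hb
  have hAC := antiBlocking_smul (antiBlocking_chain P) ha
  constructor
  · rintro ⟨p, hp, q, hq, hx⟩
    have hp0 : ∀ i, 0 ≤ p i := hull_set_nonneg _ hp
    have hq0 : ∀ i, 0 ≤ q i := hull_set_nonneg _ hq
    obtain ⟨hp1, hp2⟩ := order_ineq P hp
    have hxi : ∀ i, x i = a * p i - b * q i := fun i => by simp [hx]
    have hy : ∀ i, hull P x i ≤ a * p i := by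
      apply hull_le P (p := fun i => a * p i)
      · exact fun i => mul_nonneg ha (hp0 i)
      · exact fun i j h => mul_le_mul_of_nonneg_left (hp2 i j h) ha
      · intro i
        rw [hxi]
        linarith [mul_nonneg hb (hq0 i)]
    obtain ⟨-, p', hp', h1⟩ := layer P _ (hull P x) a le_rfl ha (hull_nonneg P x)
      (fun i => (hy i).trans (mul_le_of_le_one_right ha (hp1 i)))
      (fun i j h => hull_anti P x h)
    have h2 : (fun i => hull P x i - x i) ∈ b • stableSetPolytope G := by
      apply hAB _ (b • q) _ _ ⟨q, hq, rfl⟩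
      · intro i
        exact sub_nonneg.2 (le_max_left _ _)
      · intro i
        have h3 := hy i
        have h4 := hxi i
        simp only [Pi.smul_apply, smul_eq_mul]
        linarith
    obtain ⟨q', hq', h3⟩ := h2
    refine ⟨p', hp', q', hq', ?_⟩
    funext i
    have e1 := congrFun h1 i
    have e2 := congrFun h3 i
    simp only at e1 e2
    rw [Pi.sub_apply, e1, e2]
    simp only [transfer, upMax_hull]
    ring
  · rintro ⟨p, hp, q, hq, hz⟩
    have hp0 : ∀ i, 0 ≤ p i := hull_set_nonneg _ hp
    have hq0 : ∀ i, 0 ≤ q i := hull_set_nonneg _ hq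
    have hzi : ∀ i, transfer P x i = a * p i - b * q i := fun i => by simp [hz]
    have hle : ∀ i, hull P x i ≤ a := by
      intro i
      obtain ⟨c, -, hc2, hc3⟩ := exists_chain P x i
      have h1 := chain_ineq P hp c hc2
      calc hull P x i ≤ ∑ j ∈ c, max (transfer P x j) 0 := hc3
        _ ≤ ∑ j ∈ c, a * p j := by
          apply Finset.sum_le_sum
          intro j _
          apply max_le
          · rw [hzi]; linarith [mul_nonneg hb (hq0 j)]
          · exact mul_nonneg ha (hp0 j)
        _ = a * ∑ j ∈ c, p j := by rw [Finset.mul_sum]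
        _ ≤ a := mul_le_of_le_one_right ha h1
    obtain ⟨⟨p', hp', h1⟩, -⟩ := layer P _ (hull P x) a le_rfl ha (hull_nonneg P x) hle
      (fun i j h => hull_anti P x h)
    have h2 : (fun i => hull P x i - x i) ∈ b • stableSetPolytope G := by
      apply hAB _ (b • q) _ _ ⟨q, hq, rfl⟩
      · intro i
        exact sub_nonneg.2 (le_max_left _ _)
      · intro i
        simp only [hull_sub, Pi.smul_apply, smul_eq_mul]
        apply max_le
        · rw [hzi]; linarith [mul_nonneg ha (hp0 i)]
        · exact mul_nonneg hb (hq0 i)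
    obtain ⟨q', hq', h3⟩ := h2
    refine ⟨p', hp', q', hq', ?_⟩
    funext i
    have e1 := congrFun h1 i
    have e2 := congrFun h3 i
    simp only at e1 e2
    rw [Pi.sub_apply, e1, e2]
    ring

lemma convex_snoc_image {A : Set (Fin n → ℝ)} (hA : Convex ℝ A) (t : ℝ) :
    Convex ℝ ((fun x : Fin n → ℝ => (Fin.snoc x t : Fin (n+1) → ℝ)) '' A) := by
  rintro _ ⟨x, hx, rfl⟩ _ ⟨y, hy, rfl⟩ a b ha hb hab
  refine ⟨a • x + b • y, hA hx hy ha hb hab, ?_⟩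
  funext i
  induction i using Fin.lastCases with
  | last => simp only [Fin.snoc_last, Pi.add_apply, Pi.smul_apply, smul_eq_mul]; rw [← add_mul, hab, one_mul]
  | cast i => simp

lemma mem_smul_omega {A B : Set (Fin n → ℝ)} (hA : Convex ℝ A) (hB : Convex ℝ B)
    (hA0 : A.Nonempty) (hB0 : B.Nonempty) {m : ℝ} (hm : 0 < m) (v : Fin (n+1) → ℝ) :
    v ∈ m • omegaPolytope A B ↔ ∃ a b : ℝ, 0 ≤ a ∧ 0 ≤ b ∧ a + b = m ∧
      v (Fin.last n) = a - b ∧ ∃ p ∈ A, ∃ q ∈ B, Fin.init v = a • p - b • q := by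
  have hom : omegaPolytope A B = convexJoin ℝ
      ((fun x : Fin n → ℝ => (Fin.snoc x (1 : ℝ) : Fin (n+1) → ℝ)) '' A)
      ((fun x : Fin n → ℝ => (Fin.snoc x (-1 : ℝ) : Fin (n+1) → ℝ)) '' (-B)) := by
    unfold omegaPolytope
    rw [convexHull_union (hA0.image _) ((Set.Nonempty.neg hB0).image _),
      (convex_snoc_image hA 1).convexHull_eq, (convex_snoc_image hB.neg (-1)).convexHull_eq]
  rw [hom]
  constructor
  · rintro ⟨w, hw, rfl⟩
    rw [mem_convexJoin] at hw
    obtain ⟨_, ⟨p, hp, rfl⟩, _, ⟨q, hq, rfl⟩, a, b, ha, hb, hab, rfl⟩ := hw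
    refine ⟨m * a, m * b, by positivity, by positivity, by rw [← mul_add, hab, mul_one], ?_,
      p, hp, -q, hq, ?_⟩
    · simp; ring
    · funext i
      simp [Fin.init]; ring
  · rintro ⟨a, b, ha, hb, hab, hl, p, hp, q, hq, hi⟩
    refine ⟨m⁻¹ • v, ?_, by simp [smul_smul, hm.ne']⟩
    rw [mem_convexJoin]
    refine ⟨_, ⟨p, hp, rfl⟩, _, ⟨-q, by simpa using hq, rfl⟩, m⁻¹ * a, m⁻¹ * b, by positivity,
      by positivity, by rw [← mul_add, hab, inv_mul_cancel₀ hm.ne'], ?_⟩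
    funext i
    induction i using Fin.lastCases with
    | last => simp [hl]; ring
    | cast i =>
      have := congrFun hi i
      simp only [Fin.init, Pi.sub_apply, Pi.smul_apply, smul_eq_mul] at this
      simp [this]; ring

/-- The transfer map applied to the first `n` coordinates. -/
noncomputable def liftT (P : PartialOrder (Fin n)) (v : Fin (n+1) → ℝ) : Fin (n+1) → ℝ :=
  Fin.snoc (transfer P (Fin.init v)) (v (Fin.last n))

lemma lattice_iff (v : Fin (n+1) → ℝ) :
    IsLatticePoint v ↔ IsLatticePoint (Fin.init v : Fin n → ℝ) ∧ ∃ z : ℤ, v (Fin.last n) = z := by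
  constructor
  · exact fun h => ⟨fun i => h i.castSucc, h _⟩
  · rintro ⟨h1, h2⟩ i
    induction i using Fin.lastCases with
    | last => exact h2
    | cast i => exact h1 i

lemma init_liftT (P : PartialOrder (Fin n)) (v : Fin (n+1) → ℝ) :
    (Fin.init (liftT P v) : Fin n → ℝ) = transfer P (Fin.init v) := by
  simp [liftT]

lemma last_liftT (P : PartialOrder (Fin n)) (v : Fin (n+1) → ℝ) :
    liftT P v (Fin.last n) = v (Fin.last n) := by
  simp [liftT]

lemma ext_init {v w : Fin (n+1) → ℝ} (h : (Fin.init v : Fin n → ℝ) = Fin.init w)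
    (hl : v (Fin.last n) = w (Fin.last n)) : v = w := by
  funext i
  induction i using Fin.lastCases with
  | last => exact hl
  | cast i => exact congrFun h i

lemma liftT_injective (P : PartialOrder (Fin n)) : Function.Injective (liftT P) := by
  intro v w h
  apply ext_init
  · apply transfer_injective P
    rw [← init_liftT, ← init_liftT, h]
  · rw [← last_liftT P v, ← last_liftT P w, h]

lemma liftT_surjective (P : PartialOrder (Fin n)) : Function.Surjective (liftT P) := by
  intro w
  obtain ⟨x, hx⟩ := transfer_surjective P (Fin.init w)
  refine ⟨Fin.snoc x (w (Fin.last n)), ext_init ?_ ?_⟩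
  · rw [init_liftT]; simp [hx]
  · rw [last_liftT]; simp

lemma count_eq (P : PartialOrder (Fin n)) (G : SimpleGraph (Fin n)) {m : ℝ} (hm : 0 < m) :
    latticePointCount (m • omegaPolytope (orderPolytope P) (stableSetPolytope G)) =
      latticePointCount (m • omegaPolytope (chainPolytope P) (stableSetPolytope G)) := by
  have hmem : ∀ v, v ∈ m • omegaPolytope (orderPolytope P) (stableSetPolytope G) ↔
      liftT P v ∈ m • omegaPolytope (chainPolytope P) (stableSetPolytope G) := by
    intro v
    rw [mem_smul_omega (convex_order P) (convex_stable G)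
        ⟨_, order_gen P (I := ∅) (fun i hi => hi.elim)⟩
        ⟨_, stable_gen G (I := ∅) (fun i hi => hi.elim)⟩ hm,
      mem_smul_omega (convex_chain P) (convex_stable G)
        ⟨_, chain_gen P (I := ∅) (fun i hi => hi.elim)⟩
        ⟨_, stable_gen G (I := ∅) (fun i hi => hi.elim)⟩ hm, init_liftT, last_liftT]
    constructor
    · rintro ⟨a, b, ha, hb, hab, hl, h⟩
      exact ⟨a, b, ha, hb, hab, hl, (key_iff P G ha hb _).1 h⟩
    · rintro ⟨a, b, ha, hb, hab, hl, h⟩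
      exact ⟨a, b, ha, hb, hab, hl, (key_iff P G ha hb _).2 h⟩
  have hlat : ∀ v, IsLatticePoint (liftT P v) ↔ IsLatticePoint v := by
    intro v
    rw [lattice_iff, lattice_iff v, init_liftT, last_liftT, transfer_lattice]
  unfold latticePointCount
  rw [← Set.ncard_image_of_injective _ (liftT_injective P)]
  congr 1
  ext w
  constructor
  · rintro ⟨v, ⟨h1, h2⟩, rfl⟩
    exact ⟨(hmem v).1 h1, (hlat v).2 h2⟩
  · rintro ⟨h1, h2⟩
    obtain ⟨v, rfl⟩ := liftT_surjective P w
    exact ⟨v, ⟨(hmem v).2 h1, (hlat v).1 h2⟩, rfl⟩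

end Transfer

/-- For a poset `P` on `[d]` and a perfect graph `G` on `[d]` (`d ≥ 1`),
`δ(Ω(O_P, Q_G), λ) = δ(Ω(C_P, Q_G), λ)`. -/
theorem delta_omega_order_eq_chain (d : ℕ) (hd : 1 ≤ d) (P : PartialOrder (Fin d))
    (G : SimpleGraph (Fin d)) (hG : IsPerfectGraph G) :
    deltaPolynomial (omegaPolytope (orderPolytope P) (stableSetPolytope G)) =
      deltaPolynomial (omegaPolytope (chainPolytope P) (stableSetPolytope G)) := by
  have h : ehrhartSeries (omegaPolytope (orderPolytope P) (stableSetPolytope G)) =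
      ehrhartSeries (omegaPolytope (chainPolytope P) (stableSetPolytope G)) := by
    unfold ehrhartSeries
    congr 1
    funext m
    by_cases hm : m = 0
    · simp [hm]
    · rw [if_neg hm, if_neg hm, count_eq P G (m := (m : ℝ)) (by positivity)]
  unfold deltaPolynomial
  rw [h]

end HibiTsuchiya
end

section
/- A finite simple graph G on [d] = {1,...,d} is perfect if and only if for every finite partially ordered set P on [d] the polytope Γ(O_P, Q_G) = conv(O_P ∪ (−Q_G)) is reflexive, and also if and only if there exists a finite partially ordered set P on [d] such that Γ(O_P, Q_G) is reflexive. -/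
open scoped Pointwise

namespace HibiTsuchiya

open Classical in
/-- The common polyhedral certificate: the stable sets and cliques of `G` are antiblocking. -/
def Star {d : ℕ} (G : SimpleGraph (Fin d)) : Prop :=
  ∀ (y h : Fin d → ℝ) (a b : ℝ), (∀ i, 0 ≤ y i) → (∀ i, 0 ≤ h i) →
    (∀ S : Finset (Fin d), IsStableSet G (S : Set (Fin d)) → ∑ i ∈ S, y i ≤ a) →
    (∀ K : Finset (Fin d), G.IsClique (K : Set (Fin d)) → ∑ i ∈ K, h i ≤ b) →
    ∑ i, h i * y i ≤ a * b

lemma sum_indicator {d : ℕ} (x : Fin d → ℝ) (S : Finset (Fin d)) :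
    ∑ i, x i * indicator (S : Set (Fin d)) i = ∑ i ∈ S, x i := by
  classical
  simp [indicator, Set.indicator_apply, Finset.sum_ite_mem]

lemma convex_half {d : ℕ} (x : Fin d → ℝ) (r : ℝ) : Convex ℝ {y : Fin d → ℝ | ∑ i, x i * y i ≤ r} := by
  apply convex_halfSpace_le
  constructor
  · intro u v; simp [mul_add, Finset.sum_add_distrib]
  · intro c u; simp only [Pi.smul_apply, smul_eq_mul, Finset.mul_sum]
    exact Finset.sum_congr rfl fun i _ => by ring

lemma mem_dual {d : ℕ} (P : PartialOrder (Fin d)) (G : SimpleGraph (Fin d)) (x : Fin d → ℝ) :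
    x ∈ dualPolytope (gammaPolytope (orderPolytope P) (stableSetPolytope G)) ↔
      (∀ I : Finset (Fin d), IsPosetIdeal P (I : Set (Fin d)) → ∑ i ∈ I, x i ≤ 1) ∧
      (∀ S : Finset (Fin d), IsStableSet G (S : Set (Fin d)) → -1 ≤ ∑ i ∈ S, x i) := by
  constructor
  · intro hx
    constructor
    · intro I hI
      rw [← sum_indicator]
      exact hx _ (subset_convexHull ℝ _ (Or.inl (subset_convexHull ℝ _ ⟨_, hI, rfl⟩)))
    · intro S hS
      have := hx (-indicator (S : Set (Fin d))) (subset_convexHull ℝ _ (Or.inr (by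
        rw [Set.mem_neg, neg_neg]
        exact subset_convexHull ℝ _ ⟨_, hS, rfl⟩)))
      simp only [Pi.neg_apply, mul_neg, Finset.sum_neg_distrib] at this
      rw [sum_indicator] at this
      linarith
  · rintro ⟨h1, h2⟩ y hy
    have key : gammaPolytope (orderPolytope P) (stableSetPolytope G) ⊆
        {y : Fin d → ℝ | ∑ i, x i * y i ≤ 1} := by
      apply convexHull_min _ (convex_half x 1)
      apply Set.union_subset
      · apply convexHull_min _ (convex_half x 1)
        rintro _ ⟨I, hI, rfl⟩
        lift I to Finset (Fin d) using Set.toFinite I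
        simpa [sum_indicator] using h1 I hI
      · intro z hz
        rw [Set.mem_neg] at hz
        have : stableSetPolytope G ⊆ {y : Fin d → ℝ | ∑ i, (-x) i * y i ≤ 1} := by
          apply convexHull_min _ (convex_half (-x) 1)
          rintro _ ⟨I, hI, rfl⟩
          lift I to Finset (Fin d) using Set.toFinite I
          have := h2 I hI
          simp only [Set.mem_ofPred_eq, sum_indicator]
          simp only [Pi.neg_apply, Finset.sum_neg_distrib]
          linarith
        simpa using this hz
    exact key hy

lemma zero_mem_interior {d : ℕ} (P : PartialOrder (Fin d)) (G : SimpleGraph (Fin d)) :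
    (0 : Fin d → ℝ) ∈ interior (gammaPolytope (orderPolytope P) (stableSetPolytope G)) := by
  classical
  rw [mem_interior]
  refine ⟨{x | 0 < (1 + ∑ i, x i) / (d + 1)} ∩ ⋂ i, {x | x i < (1 + ∑ i, x i) / (d + 1)},
    ?_, ?_, ?_⟩
  · rintro x ⟨h0, h1⟩
    simp only [Set.mem_ofPred_eq, Set.mem_iInter] at h0 h1
    set t := (1 + ∑ i, x i) / ((d : ℝ) + 1) with ht
    have hconv : Convex ℝ (gammaPolytope (orderPolytope P) (stableSetPolytope G)) :=
      convex_convexHull ℝ _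
    have := hconv.sum_mem (t := (Finset.univ : Finset (Option (Fin d))))
      (w := fun o => o.elim t (fun i => t - x i))
      (z := fun o => o.elim (indicator (Set.univ)) (fun i => - indicator ({i} : Set (Fin d))))
      ?_ ?_ ?_
    · convert this using 1
      ext j
      simp [Fintype.sum_option, indicator, Finset.sum_apply, Pi.single_apply]
    · rintro (_ | i) _
      · exact h0.le
      · have := h1 i
        simp only [Option.elim]; linarith
    · simp only [Fintype.sum_option, Option.elim, Finset.sum_sub_distrib, Finset.sum_const,
        Finset.card_univ, Fintype.card_fin, nsmul_eq_mul]
      have : t * ((d : ℝ) + 1) = 1 + ∑ i, x i := by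
        rw [ht]; field_simp
      linarith
    · rintro (_ | i) _
      · exact subset_convexHull ℝ _ (Or.inl (subset_convexHull ℝ _
          ⟨_, fun _ _ _ _ => Set.mem_univ _, rfl⟩))
      · refine subset_convexHull ℝ _ (Or.inr ?_)
        rw [Set.mem_neg]
        simp only [Option.elim, neg_neg]
        refine subset_convexHull ℝ _ ⟨_, ?_, rfl⟩
        rintro _ rfl _ rfl
        exact G.irrefl
  · apply IsOpen.inter
    · exact isOpen_lt (by fun_prop) (by fun_prop)
    · exact isOpen_iInter_of_finite fun i => isOpen_lt (by fun_prop) (by fun_prop)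
  · have : (0 : ℝ) < 1 / (d + 1) := by positivity
    simp only [Set.mem_inter_iff, Set.mem_iInter, Set.mem_ofPred_eq, Pi.zero_apply,
      Finset.sum_const_zero, add_zero]
    exact ⟨this, fun _ => this⟩

lemma layer_s8 {d : ℕ} (P : PartialOrder (Fin d)) (x : Fin d → ℝ)
    (hx : ∀ I : Finset (Fin d), IsPosetIdeal P (I : Set (Fin d)) → ∑ i ∈ I, x i ≤ 1) :
    ∀ (n : ℕ) (g : Fin d → ℝ) (M : ℝ), (Finset.univ.filter (fun i => 0 < g i)).card = n →
      (∀ i, 0 ≤ g i) → (∀ i j, P.le j i → g i ≤ g j) → 0 ≤ M → (∀ i, g i ≤ M) →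
      ∑ i, g i * x i ≤ M := by
  classical
  intro n
  induction n using Nat.strong_induction_on with
  | _ n ih =>
  intro g M hn h0 hg hM hgM
  set I := Finset.univ.filter (fun i => 0 < g i) with hI
  by_cases hne : I.Nonempty
  · obtain ⟨i0, hi0, hmin⟩ := I.exists_min_image g hne
    have hi0' : 0 < g i0 := by simpa [hI] using hi0
    have hz : ∀ i, i ∉ I → g i = 0 := fun i hi => by
      have : ¬ 0 < g i := by simpa [hI] using hi
      exact le_antisymm (not_lt.mp this) (h0 i)
    set g' : Fin d → ℝ := fun i => if i ∈ I then g i - g i0 else 0 with hg'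
    have hsub : (Finset.univ.filter (fun i => 0 < g' i)) ⊂ I := by
      rw [Finset.ssubset_iff_of_subset]
      · exact ⟨i0, hi0, by simp [hg', hi0]⟩
      · intro i hi
        by_contra hc
        simp [hg', hc] at hi
    have hideal : ∀ i ∈ I, ∀ j, P.le j i → j ∈ I := by
      intro i hi j hji
      have h1 := hg i j hji
      have : 0 < g i := by simpa [hI] using hi
      simp only [hI, Finset.mem_filter, Finset.mem_univ, true_and]
      linarith
    have := ih _ (hn ▸ Finset.card_lt_card hsub) g' (M - g i0) rfl ?_ ?_ ?_ ?_
    · have h2 := hx I (fun i hi j hji => by exact_mod_cast hideal i (by exact_mod_cast hi) j hji)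
      have h3 : ∑ i, g i * x i = ∑ i, g' i * x i + g i0 * ∑ i ∈ I, x i := by
        rw [Finset.mul_sum, ← Finset.sum_filter_add_sum_filter_not Finset.univ (· ∈ I),
          ← Finset.sum_filter_add_sum_filter_not Finset.univ (· ∈ I) (fun i => g' i * x i)]
        have e1 : ∑ i with i ∉ I, g i * x i = 0 := Finset.sum_eq_zero fun i hi => by
          rw [hz i (by simpa using hi), zero_mul]
        have e2 : ∑ i with i ∉ I, g' i * x i = 0 := Finset.sum_eq_zero fun i hi => by
          have : i ∉ I := by simpa using hi
          simp [hg', this]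
        rw [e1, e2]
        simp only [Finset.filter_mem_eq_inter, Finset.univ_inter, add_zero]
        rw [← Finset.sum_add_distrib]
        exact Finset.sum_congr rfl fun i hi => by simp only [hg', hi, if_true]; ring
      nlinarith
    · intro i
      by_cases h : i ∈ I
      · simpa [hg', h] using hmin i h
      · simp [hg', h]
    · intro i j hji
      by_cases h : i ∈ I
      · have := hideal i h j hji
        simpa [hg', h, this] using hg i j hji
      · by_cases h' : j ∈ I
        · simpa [hg', h, h'] using hmin j h'
        · simp [hg', h, h']
    · linarith [hgM i0]
    · intro i
      have := hgM i
      have := hgM i0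
      by_cases h : i ∈ I
      · simp [hg', h]; linarith
      · simp [hg', h]; linarith
  · have : ∀ i, g i = 0 := fun i => by
      have : ¬ 0 < g i := fun h => hne ⟨i, by simpa [hI] using h⟩
      exact le_antisymm (not_lt.mp this) (h0 i)
    simpa [this] using hM

lemma clique_inter_stable {d : ℕ} {G : SimpleGraph (Fin d)} {K S : Finset (Fin d)}
    (hK : G.IsClique (K : Set (Fin d))) (hS : IsStableSet G (S : Set (Fin d))) :
    (K ∩ S).card ≤ 1 := by
  rw [Finset.card_le_one]
  intro a ha b hb
  rw [Finset.mem_inter] at ha hb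
  by_contra hne
  exact hS a (by exact_mod_cast ha.2) b (by exact_mod_cast hb.2)
    (hK (by exact_mod_cast ha.1) (by exact_mod_cast hb.1) hne)

/-- reflexive for some poset implies the certificate -/
lemma star_of_reflexive {d : ℕ} (P : PartialOrder (Fin d)) (G : SimpleGraph (Fin d))
    (hR : IsReflexive (gammaPolytope (orderPolytope P) (stableSetPolytope G))) : Star G := by
  classical
  obtain ⟨-, V, hV, hD⟩ := hR
  intro y h a b hy hh hya hhb
  have ha : 0 ≤ a := by simpa using hya ∅ (by intro i hi; simp at hi)
  rcases ha.eq_or_lt with ha | ha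
  · have : ∀ i, y i = 0 := fun i => by
      have := hya {i} (by
        intro p hp q hq
        simp only [Finset.coe_singleton, Set.mem_singleton_iff] at hp hq
        subst hp; subst hq; exact G.irrefl)
      rw [Finset.sum_singleton, ← ha] at this
      exact le_antisymm this (hy i)
    simp [this, ← ha]
  have hx : (fun i => - y i / a) ∈ convexHull ℝ (V : Set (Fin d → ℝ)) := by
    rw [← hD, mem_dual]
    constructor
    · intro I _
      have : ∑ i ∈ I, - y i / a ≤ 0 := Finset.sum_nonpos fun i _ => by
        rw [neg_div]; have := div_nonneg (hy i) ha.le; linarith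
      linarith
    · intro S hS
      rw [← Finset.sum_div, Finset.sum_neg_distrib, neg_div, neg_le_neg_iff, div_le_one ha]
      exact hya S hS
  by_contra hcon
  push Not at hcon
  have hsub : convexHull ℝ (V : Set (Fin d → ℝ)) ⊆ {z | ∑ i, (-h) i * z i ≤ b} := by
    apply convexHull_min _ (convex_half _ _)
    intro v hv
    have hvD : v ∈ dualPolytope (gammaPolytope (orderPolytope P) (stableSetPolytope G)) := by
      rw [hD]; exact subset_convexHull ℝ _ hv
    rw [mem_dual] at hvD
    have hvl := hV v hv
    have hge : ∀ i, -1 ≤ v i := fun i => by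
      have := hvD.2 {i} (by
        intro p hp q hq
        simp only [Finset.coe_singleton, Set.mem_singleton_iff] at hp hq
        subst hp; subst hq; exact G.irrefl)
      simpa using this
    have hneg : ∀ i, v i < 0 → v i ≤ -1 := fun i hi => by
      obtain ⟨z, hz⟩ := hvl i
      rw [hz] at hi ⊢
      have : z < 0 := by exact_mod_cast hi
      have : z ≤ -1 := by omega
      exact_mod_cast this
    have hcl : G.IsClique ((Finset.univ.filter (fun i => v i < 0) : Finset (Fin d)) : Set (Fin d)) := by
      intro i hi j hj hij
      by_contra hadj
      simp only [Finset.coe_filter, Finset.mem_univ, true_and, Set.mem_ofPred_eq] at hi hj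
      have := hvD.2 {i, j} (by
        intro p hp q hq hpq
        simp only [Finset.coe_insert, Finset.coe_singleton, Set.mem_insert_iff,
          Set.mem_singleton_iff] at hp hq
        rcases hp with rfl | rfl <;> rcases hq with rfl | rfl
        · exact G.irrefl hpq
        · exact hadj hpq
        · exact hadj hpq.symm
        · exact G.irrefl hpq)
      rw [Finset.sum_pair hij] at this
      linarith [hneg i hi, hneg j hj]
    have := hhb _ hcl
    refine le_trans ?_ this
    rw [Finset.sum_filter]
    apply Finset.sum_le_sum
    intro i _
    simp only [Pi.neg_apply]
    split_ifs with hi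
    · nlinarith [hh i, hge i]
    · nlinarith [hh i, not_lt.mp hi]
  have := hsub hx
  simp only [Set.mem_ofPred_eq, Pi.neg_apply] at this
  have e : ∑ i, -h i * (-y i / a) = (∑ i, h i * y i) / a := by
    rw [Finset.sum_div]
    exact Finset.sum_congr rfl fun i _ => by ring
  rw [e, div_le_iff₀ ha] at this
  linarith

lemma coloring_of_star {d : ℕ} {G : SimpleGraph (Fin d)} (hs : Star G) :
    ∀ (k : ℕ) (U : Finset (Fin d)),
      (∀ K : Finset (Fin d), K ⊆ U → G.IsClique (K : Set (Fin d)) → K.card ≤ k) →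
      ∃ c : Fin d → ℕ, (∀ v ∈ U, c v < k) ∧ ∀ u ∈ U, ∀ v ∈ U, G.Adj u v → c u ≠ c v := by
  classical
  intro k
  induction k with
  | zero =>
    intro U hU
    have : ∀ v, v ∉ U := fun v hv => by
      have := hU {v} (by simpa using hv) (by simp)
      simp at this
    exact ⟨fun _ => 0, fun v hv => absurd hv (this v), fun v hv => absurd hv (this v)⟩
  | succ k ih =>
    intro U hU
    set Ks : Finset (Finset (Fin d)) :=
      Finset.univ.filter (fun K => K ⊆ U ∧ G.IsClique (K : Set (Fin d)) ∧ K.card = k + 1) with hKs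
    have hex : ∃ S : Finset (Fin d), IsStableSet G (S : Set (Fin d)) ∧
        ∀ K ∈ Ks, (K ∩ S).card ≠ 0 := by
      by_contra hcon
      push Not at hcon
      have hcl : ∀ K ∈ Ks, K ⊆ U ∧ G.IsClique (K : Set (Fin d)) ∧ K.card = k + 1 := by
        intro K hK; simpa [hKs] using hK
      have hφ : ∀ S : Finset (Fin d), ∑ i ∈ S, (∑ K ∈ Ks, if i ∈ K then (1 : ℝ) else 0)
          = ∑ K ∈ Ks, ((K ∩ S).card : ℝ) := by
        intro S
        rw [Finset.sum_comm]
        refine Finset.sum_congr rfl fun K _ => ?_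
        rw [Finset.sum_boole, Finset.filter_mem_eq_inter, Finset.inter_comm]
      have := hs (fun i => ∑ K ∈ Ks, if i ∈ K then (1 : ℝ) else 0)
        (fun i => if i ∈ U then 1 else 0) (Ks.card - 1) (k + 1)
        (fun i => Finset.sum_nonneg fun K _ => by split_ifs <;> norm_num)
        (fun i => by split_ifs <;> norm_num)
        (by
          intro S hS
          rw [hφ]
          obtain ⟨K0, hK0, hz⟩ := hcon S hS
          rw [← Finset.add_sum_erase _ _ hK0, hz]
          have : ∑ K ∈ Ks.erase K0, ((K ∩ S).card : ℝ) ≤ ∑ K ∈ Ks.erase K0, 1 :=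
            Finset.sum_le_sum fun K hK => by
              exact_mod_cast clique_inter_stable (hcl K (Finset.mem_of_mem_erase hK)).2.1 hS
          rw [Finset.sum_const, Finset.card_erase_of_mem hK0, nsmul_eq_mul, mul_one,
            Nat.cast_sub (Finset.card_pos.mpr ⟨K0, hK0⟩)] at this
          simpa using this)
        (by
          intro K hK
          rw [Finset.sum_boole, Finset.filter_mem_eq_inter]
          exact_mod_cast hU (K ∩ U) Finset.inter_subset_right
            (hK.subset (by exact_mod_cast Finset.inter_subset_left)))
      have e : ∑ i, (if i ∈ U then (1 : ℝ) else 0) * (∑ K ∈ Ks, if i ∈ K then (1 : ℝ) else 0)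
          = Ks.card * (k + 1) := by
        have : ∑ i, (if i ∈ U then (1 : ℝ) else 0) * (∑ K ∈ Ks, if i ∈ K then (1 : ℝ) else 0)
          = ∑ i ∈ U, (∑ K ∈ Ks, if i ∈ K then (1 : ℝ) else 0) := by
          simp only [ite_mul, one_mul, zero_mul, Finset.sum_ite_mem, Finset.univ_inter]
        rw [this, hφ]
        rw [Finset.sum_congr rfl (g := fun _ => ((k : ℝ) + 1))]
        · simp; ring
        · intro K hK
          obtain ⟨h1, -, h3⟩ := hcl K hK
          rw [Finset.inter_eq_left.mpr h1, h3]; push_cast; ring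
      rw [e] at this
      have hk : (0 : ℝ) ≤ k := Nat.cast_nonneg k
      nlinarith
    obtain ⟨S, hS, hmeet⟩ := hex
    obtain ⟨c, hc1, hc2⟩ := ih (U \ S) (by
      intro K hK hKc
      have hKU : K ⊆ U := hK.trans Finset.sdiff_subset
      have h1 := hU K hKU hKc
      by_contra hlt
      have : K ∈ Ks := by
        simp only [hKs, Finset.mem_filter, Finset.mem_univ, true_and]
        exact ⟨hKU, hKc, by omega⟩
      apply hmeet K this
      rw [Finset.card_eq_zero, ← Finset.disjoint_iff_inter_eq_empty]
      exact Finset.disjoint_of_subset_left hK Finset.sdiff_disjoint)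
    refine ⟨fun v => if v ∈ S then k else c v, ?_, ?_⟩
    · intro v hv
      dsimp only
      split_ifs with h
      · omega
      · have := hc1 v (by simp [hv, h]); omega
    · intro u hu v hv huv
      dsimp only
      split_ifs with h1 h2 h2
      · exact absurd huv (hS u (by exact_mod_cast h1) v (by exact_mod_cast h2))
      · have := hc1 v (by simp [hv, h2]); omega
      · have := hc1 u (by simp [hu, h1]); omega
      · exact hc2 u (by simp [hu, h1]) v (by simp [hv, h2]) huv

lemma clique_le_chromatic {V : Type*} (H : SimpleGraph V) :
    cliqueNumber H ≤ H.chromaticNumber := by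
  refine iSup_le fun t => iSup_le fun ht => ?_
  exact ht.card_le_chromaticNumber

lemma perfect_of_star {d : ℕ} {G : SimpleGraph (Fin d)} (hs : Star G) : IsPerfectGraph G := by
  classical
  intro s
  apply le_antisymm _ (clique_le_chromatic _)
  obtain ⟨U, rfl⟩ : ∃ U : Finset (Fin d), (U : Set (Fin d)) = s :=
    ⟨(Set.toFinite s).toFinset, by simp⟩
  by_cases htop : cliqueNumber (G.induce (U : Set (Fin d))) = ⊤
  · rw [htop]; exact le_top
  obtain ⟨k, hk⟩ := ENat.ne_top_iff_exists.mp htop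
  rw [← hk]
  obtain ⟨c, hc1, hc2⟩ := coloring_of_star hs k U (by
    intro K hKU hK
    have hcl : (G.induce (U : Set (Fin d))).IsClique
        ((K.subtype (fun v => v ∈ (U : Set (Fin d))) : Finset (U : Set (Fin d))) : Set (U : Set (Fin d))) := by
      intro a ha b hb hab
      simp only [Finset.mem_coe, Finset.mem_subtype] at ha hb
      exact hK ha hb (fun h => hab (Subtype.ext h))
    have h1 : ((K.subtype (fun v => v ∈ (U : Set (Fin d)))).card : ℕ∞) ≤ k := by
      rw [hk]
      exact le_iSup₂_of_le _ hcl le_rfl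
    have h2 : (K.subtype (fun v => v ∈ (U : Set (Fin d)))).card = K.card := by
      rw [Finset.card_subtype, Finset.filter_true_of_mem]
      intro x hx; exact_mod_cast hKU hx
    rw [h2] at h1
    exact_mod_cast h1)
  rw [SimpleGraph.chromaticNumber_le_iff_colorable]
  refine ⟨SimpleGraph.Coloring.mk (fun v => (⟨c v, hc1 v v.2⟩ : Fin k)) ?_⟩
  intro u v huv h
  exact hc2 u u.2 v v.2 huv (by simpa using h)

lemma coloring_of_perfect {d : ℕ} {G : SimpleGraph (Fin d)} (hG : IsPerfectGraph G)
    (k : ℕ) (U : Finset (Fin d))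
    (h : ∀ K : Finset (Fin d), K ⊆ U → G.IsClique (K : Set (Fin d)) → K.card ≤ k) :
    ∃ f : Fin k → Finset (Fin d), (∀ i, IsStableSet G (f i : Set (Fin d))) ∧
      ∀ v, (if v ∈ U then 1 else 0) = ∑ i, if v ∈ f i then 1 else 0 := by
  classical
  have h1 := hG (U : Set (Fin d))
  have h2 : cliqueNumber (G.induce (U : Set (Fin d))) ≤ k := by
    refine iSup_le fun t => iSup_le fun ht => ?_
    have := h (t.map (Function.Embedding.subtype _)) (by
      intro x hx
      simp only [Finset.mem_map, Function.Embedding.subtype_apply] at hx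
      obtain ⟨a, -, rfl⟩ := hx
      exact a.2) (by
      intro a ha b hb hab
      simp only [Finset.coe_map, Set.mem_image, Function.Embedding.subtype_apply] at ha hb
      obtain ⟨a, ha, rfl⟩ := ha
      obtain ⟨b, hb, rfl⟩ := hb
      exact ht ha hb (fun h => hab (congrArg _ h)))
    rw [Finset.card_map] at this
    exact_mod_cast this
  rw [← h1, SimpleGraph.chromaticNumber_le_iff_colorable] at h2
  obtain ⟨C⟩ := h2
  refine ⟨fun i => Finset.univ.filter (fun v => ∃ hv : v ∈ U, C ⟨v, hv⟩ = i), ?_, ?_⟩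
  · intro i u hu v hv huv
    simp only [Finset.coe_filter, Finset.mem_univ, true_and, Set.mem_ofPred_eq] at hu hv
    obtain ⟨hu, hu'⟩ := hu
    obtain ⟨hv, hv'⟩ := hv
    exact C.valid (v := ⟨u, hu⟩) (w := ⟨v, hv⟩) huv (hu'.trans hv'.symm)
  · intro v
    by_cases hv : v ∈ U
    · simp [hv]
    · simp [hv]

/-- weighted replication lemma -/
lemma replication {d : ℕ} {G : SimpleGraph (Fin d)} (hG : IsPerfectGraph G) :
    ∀ (n : ℕ) (w : Fin d → ℕ) (k : ℕ), ∑ v, w v = n →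
      (∀ K : Finset (Fin d), G.IsClique (K : Set (Fin d)) → ∑ v ∈ K, w v ≤ k) →
      ∃ f : Fin k → Finset (Fin d), (∀ i, IsStableSet G (f i : Set (Fin d))) ∧
        ∀ v, w v = ∑ i, if v ∈ f i then 1 else 0 := by
  classical
  intro n
  induction n using Nat.strong_induction_on with
  | _ n ih =>
  intro w k hn hw
  by_cases hle : ∀ v, w v ≤ 1
  · obtain ⟨f, hf1, hf2⟩ := coloring_of_perfect hG k (Finset.univ.filter (fun v => w v = 1)) (by
      intro K hKU hK
      refine le_trans ?_ (hw K hK)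
      rw [Finset.card_eq_sum_ones]
      exact Finset.sum_le_sum fun v hv => by
        have := hKU hv
        simp only [Finset.mem_filter] at this
        omega)
    refine ⟨f, hf1, fun v => ?_⟩
    rw [← hf2]
    have := hle v
    simp only [Finset.mem_filter, Finset.mem_univ, true_and]
    split_ifs <;> omega
  push Not at hle
  obtain ⟨v, hv⟩ := hle
  have hwlt : ∀ w' : Fin d → ℕ, (∀ u, w' u ≤ w u) → w' v < w v → ∑ u, w' u < n := by
    intro w' h1 h2
    rw [← hn]
    exact Finset.sum_lt_sum (fun u _ => h1 u) ⟨v, Finset.mem_univ _, h2⟩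
  set w' : Fin d → ℕ := fun u => if u = v then w u - 1 else w u with hw'
  have hw'le : ∀ u, w' u ≤ w u := fun u => by simp only [hw']; split_ifs <;> omega
  obtain ⟨f, hf1, hf2⟩ := ih _ (hwlt w' hw'le (by simp only [hw', if_true]; omega)) w' k rfl
    (fun K hK => (Finset.sum_le_sum fun u _ => hw'le u).trans (hw K hK))
  obtain ⟨i0, hi0⟩ : ∃ i0, v ∈ f i0 := by
    by_contra hcon
    push Not at hcon
    have := hf2 v
    simp only [hw', hcon, if_true, if_false, Finset.sum_const_zero] at this
    omega
  set S := f i0 with hS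
  have hSw : ∀ u, (if u ∈ S then 1 else 0) ≤ w u := by
    intro u
    refine le_trans ?_ (hw'le u)
    rw [hf2 u]
    exact Finset.single_le_sum (f := fun i => if u ∈ f i then 1 else 0)
      (fun _ _ => Nat.zero_le _) (Finset.mem_univ i0)
  obtain ⟨m, rfl⟩ : ∃ m, k = m + 1 := ⟨k - 1, by have := i0.2; omega⟩
  set w2 : Fin d → ℕ := fun u => w u - (if u ∈ S then 1 else 0) with hw2
  have hw2e : ∀ u, w u = (if u ∈ S then 1 else 0) + w2 u := fun u => by
    have := hSw u; simp only [hw2]; omega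
  obtain ⟨g, hg1, hg2⟩ := ih _ (hwlt w2 (fun u => Nat.sub_le _ _)
    (by simp only [hw2, hi0, if_true]; omega)) w2 m rfl (by
    intro K hK
    have e : ∑ u ∈ K, w u = (K ∩ S).card + ∑ u ∈ K, w2 u := by
      rw [Finset.sum_congr rfl (fun u _ => hw2e u), Finset.sum_add_distrib]
      simp [Finset.filter_mem_eq_inter]
    have hwK := hw K hK
    by_cases h0 : (K ∩ S).card = 0
    · have hvK : v ∉ K := fun h => by
        rw [Finset.card_eq_zero] at h0
        have : v ∈ K ∩ S := Finset.mem_inter.mpr ⟨h, hi0⟩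
        rw [h0] at this; simp at this
      have e2 : ∑ u ∈ K, w u = ∑ i, (K ∩ f i).card := by
        rw [Finset.sum_congr rfl (g := w')]
        · rw [Finset.sum_congr rfl (fun u _ => hf2 u), Finset.sum_comm]
          refine Finset.sum_congr rfl fun i _ => ?_
          simp [Finset.filter_mem_eq_inter]
        · intro u hu
          have : u ≠ v := fun h => hvK (h ▸ hu)
          simp [hw', this]
      have e3 : ∑ i, (K ∩ f i).card ≤ m := by
        rw [← Finset.add_sum_erase _ _ (Finset.mem_univ i0), ← hS, h0, zero_add]
        refine (Finset.sum_le_sum (g := fun _ => 1) fun i _ => clique_inter_stable hK (hf1 i)).trans ?_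
        simp
      omega
    · omega)
  refine ⟨Fin.cons S g, ?_, ?_⟩
  · intro i
    refine Fin.cases ?_ ?_ i
    · exact hf1 i0
    · intro j; simpa using hg1 j
  · intro u
    rw [Fin.sum_univ_succ, hw2e u, hg2 u]
    simp

lemma star_of_perfect {d : ℕ} {G : SimpleGraph (Fin d)} (hG : IsPerfectGraph G) : Star G := by
  classical
  intro y h a b hy hh hya hhb
  have hb : 0 ≤ b := by simpa using hhb ∅ (by simp)
  have ha : 0 ≤ a := by simpa using hya ∅ (by intro i hi; simp at hi)
  have key : ∀ N : ℕ, (N : ℝ) * (∑ i, h i * y i - a * b) ≤ ∑ i, y i := by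
    intro N
    obtain ⟨f, hf1, hf2⟩ := replication hG _ (fun v => ⌊(N : ℝ) * h v⌋₊) ⌊(N : ℝ) * b⌋₊ rfl (by
      intro K hK
      apply Nat.le_floor
      push_cast
      refine le_trans (Finset.sum_le_sum (g := fun v => (N : ℝ) * h v) fun v _ =>
        Nat.floor_le (mul_nonneg (Nat.cast_nonneg N) (hh v))) ?_
      rw [← Finset.mul_sum]
      exact mul_le_mul_of_nonneg_left (hhb K hK) (Nat.cast_nonneg N))
    have h1 : ∑ v, (⌊(N : ℝ) * h v⌋₊ : ℝ) * y v ≤ N * b * a := by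
      have e : ∑ v, (⌊(N : ℝ) * h v⌋₊ : ℝ) * y v = ∑ i, ∑ v ∈ f i, y v := by
        have : ∀ v, (⌊(N : ℝ) * h v⌋₊ : ℝ) * y v = ∑ i, if v ∈ f i then y v else 0 := by
          intro v
          have := hf2 v
          rw [this]
          push_cast
          rw [Finset.sum_mul]
          simp
        simp only [this]
        rw [Finset.sum_comm]
        simp [Finset.sum_ite_mem]
      rw [e]
      refine (Finset.sum_le_sum fun i _ => hya (f i) (hf1 i)).trans ?_
      simp only [Finset.sum_const, Finset.card_univ, Fintype.card_fin, nsmul_eq_mul]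
      exact mul_le_mul_of_nonneg_right (Nat.floor_le (by positivity)) ha
    have h2 : (N : ℝ) * ∑ i, h i * y i ≤ ∑ v, (⌊(N : ℝ) * h v⌋₊ : ℝ) * y v + ∑ v, y v := by
      rw [Finset.mul_sum, ← Finset.sum_add_distrib]
      refine Finset.sum_le_sum fun v _ => ?_
      have := (Nat.lt_floor_add_one ((N : ℝ) * h v)).le
      nlinarith [mul_le_mul_of_nonneg_right this (hy v)]
    linarith
  by_contra hcon
  push Not at hcon
  obtain ⟨N, hN⟩ := exists_nat_gt ((∑ i, y i) / (∑ i, h i * y i - a * b))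
  rw [div_lt_iff₀ (by linarith)] at hN
  linarith [key N]

/-- basis vector, or zero -/
def unitVec {d : ℕ} (o : Option (Fin d)) : Fin d → ℝ := fun i => if o = some i then 1 else 0

/-- the candidate vertices of the dual polytope -/
def vertexPt {d : ℕ} (p : Finset (Fin d) × (Fin d → Option (Fin d)) × Option (Fin d)) :
    Fin d → ℝ := fun i => ∑ j ∈ p.1, (unitVec (p.2.1 j) i - unitVec (some j) i) + unitVec p.2.2 i

/-- value of a functional at a unit vector -/
def optVal {d : ℕ} (c : Fin d → ℝ) (o : Option (Fin d)) : ℝ := o.elim 0 c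

lemma sum_unitVec {d : ℕ} (c : Fin d → ℝ) (o : Option (Fin d)) :
    ∑ i, c i * unitVec o i = optVal c o := by
  cases o <;> simp [unitVec, optVal]

lemma sum_vertexPt {d : ℕ} (c : Fin d → ℝ)
    (p : Finset (Fin d) × (Fin d → Option (Fin d)) × Option (Fin d)) :
    ∑ i, c i * vertexPt p i = ∑ j ∈ p.1, (optVal c (p.2.1 j) - c j) + optVal c p.2.2 := by
  simp only [vertexPt, mul_add, Finset.sum_add_distrib, sum_unitVec, Finset.mul_sum]
  rw [Finset.sum_comm]
  simp only [mul_sub, Finset.sum_sub_distrib, sum_unitVec]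
  simp [optVal]

lemma reflexive_of_star {d : ℕ} {G : SimpleGraph (Fin d)} (hs : Star G)
    (P : PartialOrder (Fin d)) :
    IsReflexive (gammaPolytope (orderPolytope P) (stableSetPolytope G)) := by
  classical
  refine ⟨zero_mem_interior P G, ?_⟩
  set A : Finset (Finset (Fin d) × (Fin d → Option (Fin d)) × Option (Fin d)) :=
    Finset.univ.filter (fun p => G.IsClique (p.1 : Set (Fin d)) ∧
      ∀ j i, p.2.1 j = some i → P.le j i) with hA
  refine ⟨A.image vertexPt, ?_, ?_⟩
  · intro v hv
    obtain ⟨p, -, rfl⟩ := Finset.mem_image.mp hv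
    have hu : ∀ (o : Option (Fin d)) i, unitVec o i = (((if o = some i then 1 else 0 : ℤ)) : ℝ) := by
      intro o i; simp [unitVec]
    intro i
    refine ⟨∑ j ∈ p.1, ((if p.2.1 j = some i then 1 else 0) - (if some j = some i then 1 else 0))
      + (if p.2.2 = some i then 1 else 0), ?_⟩
    simp only [vertexPt, hu]
    push_cast
    rfl
  apply Set.Subset.antisymm
  · intro x hx
    rw [mem_dual] at hx
    by_contra hnot
    obtain ⟨F, u, hFu, hux⟩ := geometric_hahn_banach_closed_point (convex_convexHull ℝ _)
      (Set.Finite.isClosed_convexHull ℝ (A.image vertexPt).finite_toSet) hnot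
    set c : Fin d → ℝ := fun i => F (Pi.single i 1) with hc
    have hF : ∀ z, F z = ∑ i, c i * z i := by
      intro z
      conv_lhs => rw [← Finset.univ_sum_single z]
      rw [map_sum]
      refine Finset.sum_congr rfl fun i _ => ?_
      have : (Pi.single i (z i) : Fin d → ℝ) = z i • Pi.single i 1 := by
        rw [← Pi.single_smul]; simp
      rw [this, map_smul, smul_eq_mul, mul_comm]
    -- choose the best targets
    have hτ : ∀ j : Fin d, ∃ o : Option (Fin d), (∀ i, o = some i → P.le j i) ∧
        ∀ o' : Option (Fin d), (∀ i, o' = some i → P.le j i) → optVal c o' ≤ optVal c o := by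
      intro j
      obtain ⟨o, ho, hmax⟩ := (Finset.univ.filter
        (fun o : Option (Fin d) => ∀ i, o = some i → P.le j i)).exists_max_image (optVal c)
        ⟨none, by simp⟩
      exact ⟨o, by simpa using ho, fun o' ho' => hmax o' (by simpa using ho')⟩
    choose τ hτ1 hτ2 using hτ
    obtain ⟨o0, -, ho0⟩ := (Finset.univ : Finset (Option (Fin d))).exists_max_image (optVal c)
      ⟨none, by simp⟩
    set g : Fin d → ℝ := fun j => optVal c (τ j) with hg
    have hg0 : ∀ j, 0 ≤ g j := fun j => hτ2 j none (by simp)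
    have hgc : ∀ j, c j ≤ g j := fun j => hτ2 j (some j) (by
      intro i hi
      cases hi
      exact P.le_refl j)
    have hganti : ∀ i j, P.le j i → g i ≤ g j := fun i j hji => hτ2 j (τ i) (fun l hl =>
      P.le_trans _ _ _ hji (hτ1 i l hl))
    have hM0 : 0 ≤ optVal c o0 := ho0 none (by simp)
    have hgx := layer_s8 P x hx.1 _ g (optVal c o0) rfl hg0 hganti hM0 (fun i => ho0 _ (by simp))
    have hcl : ∀ K : Finset (Fin d), G.IsClique (K : Set (Fin d)) →
        ∑ j ∈ K, (g j - c j) ≤ u - optVal c o0 := by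
      intro K hK
      have := hFu (vertexPt (K, τ, o0)) (subset_convexHull ℝ _ (by
        rw [Finset.mem_coe]
        apply Finset.mem_image_of_mem
        simp only [hA, Finset.mem_filter, Finset.mem_univ, true_and]
        exact ⟨hK, hτ1⟩))
      rw [hF, sum_vertexPt] at this
      simp only [hg]
      dsimp only at this
      linarith
    have hneg := hs (fun i => max (-x i) 0) (fun i => g i - c i) 1 (u - optVal c o0)
      (fun i => le_max_right _ _) (fun i => by have := hgc i; linarith)
      (by
        intro S hS
        have h1 := hx.2 (S.filter (fun i => x i < 0)) (by
          intro p hp q hq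
          simp only [Finset.coe_filter, Set.mem_ofPred_eq] at hp hq
          exact hS p (by exact_mod_cast hp.1) q (by exact_mod_cast hq.1))
        have h2 : ∑ i ∈ S, max (-x i) 0 = - ∑ i ∈ S with x i < 0, x i := by
          rw [Finset.sum_filter, ← Finset.sum_neg_distrib]
          refine Finset.sum_congr rfl fun i _ => ?_
          split_ifs with h
          · rw [max_eq_left (by linarith)]
          · rw [max_eq_right (by linarith)]; simp
        linarith) hcl
    have hfin : ∑ i, c i * x i ≤ ∑ i, g i * x i + ∑ i, (g i - c i) * max (-x i) 0 := by
      rw [← Finset.sum_add_distrib]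
      refine Finset.sum_le_sum fun i _ => ?_
      nlinarith [hgc i, le_max_left (-x i) 0]
    rw [hF] at hux
    linarith
  · apply convexHull_min
    · intro v hv
      obtain ⟨p, hp, rfl⟩ := Finset.mem_image.mp (by exact_mod_cast hv)
      simp only [hA, Finset.mem_filter, Finset.mem_univ, true_and] at hp
      have hsum : ∀ S : Finset (Fin d), ∑ i ∈ S, vertexPt p i =
          ∑ j ∈ p.1, (optVal (fun i => if i ∈ S then 1 else 0) (p.2.1 j) - (if j ∈ S then 1 else 0))
          + optVal (fun i => if i ∈ S then 1 else 0) p.2.2 := by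
        intro S
        rw [← sum_vertexPt]
        simp [Finset.sum_ite_mem]
      have hopt : ∀ (S : Finset (Fin d)) o, 0 ≤ optVal (fun i => if i ∈ S then (1 : ℝ) else 0) o ∧
          optVal (fun i => if i ∈ S then (1 : ℝ) else 0) o ≤ 1 := by
        intro S o
        cases o with
        | none => simp [optVal]
        | some i => simp only [optVal, Option.elim]; split_ifs <;> norm_num
      rw [mem_dual]
      constructor
      · intro I hI
        rw [hsum]
        have : ∑ j ∈ p.1, (optVal (fun i => if i ∈ I then (1 : ℝ) else 0) (p.2.1 j) -
            (if j ∈ I then 1 else 0)) ≤ 0 := by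
          refine Finset.sum_nonpos fun j _ => ?_
          cases h : p.2.1 j with
          | none => simp only [optVal, Option.elim]; split_ifs <;> norm_num
          | some i =>
            have hji := hp.2 j i h
            have := hI i
            simp only [optVal, Option.elim]
            by_cases hi : i ∈ I
            · have hj : j ∈ I := by exact_mod_cast hI i (by exact_mod_cast hi) j hji
              simp [hi, hj]
            · simp only [hi, if_false]; split_ifs <;> norm_num
        linarith [(hopt I p.2.2).2]
      · intro S hS
        rw [hsum]
        have h1 : -((p.1 ∩ S).card : ℝ) ≤ ∑ j ∈ p.1,
            (optVal (fun i => if i ∈ S then (1 : ℝ) else 0) (p.2.1 j) - (if j ∈ S then 1 else 0)) := by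
          rw [Finset.sum_sub_distrib, Finset.sum_boole, Finset.filter_mem_eq_inter]
          have : 0 ≤ ∑ j ∈ p.1, optVal (fun i => if i ∈ S then (1 : ℝ) else 0) (p.2.1 j) :=
            Finset.sum_nonneg fun j _ => (hopt S _).1
          linarith
        have h2 : ((p.1 ∩ S).card : ℝ) ≤ 1 := by exact_mod_cast clique_inter_stable hp.1 hS
        linarith [(hopt S p.2.2).1]
    · intro a ha b hb s t hs ht hst
      intro y hy
      have h1 := ha y hy
      have h2 := hb y hy
      simp only [Pi.add_apply, Pi.smul_apply, smul_eq_mul]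
      have : ∑ i, (s * a i + t * b i) * y i = s * ∑ i, a i * y i + t * ∑ i, b i * y i := by
        rw [Finset.mul_sum, Finset.mul_sum, ← Finset.sum_add_distrib]
        exact Finset.sum_congr rfl fun i _ => by ring
      rw [this]
      nlinarith

/-- **Polyhedral characterization of perfect graphs.** A finite simple graph `G` on `[d]`
is perfect if and only if `Γ(O_P, Q_G)` is reflexive for every poset `P` on `[d]`,
and also if and only if `Γ(O_P, Q_G)` is reflexive for some poset `P` on `[d]`. -/
theorem perfect_iff_gamma_reflexive (d : ℕ) (G : SimpleGraph (Fin d)) :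
    (IsPerfectGraph G ↔
      ∀ P : PartialOrder (Fin d),
        IsReflexive (gammaPolytope (orderPolytope P) (stableSetPolytope G))) ∧
    (IsPerfectGraph G ↔
      ∃ P : PartialOrder (Fin d),
        IsReflexive (gammaPolytope (orderPolytope P) (stableSetPolytope G))) := by
  have hR : ∀ P : PartialOrder (Fin d),
      IsReflexive (gammaPolytope (orderPolytope P) (stableSetPolytope G)) → IsPerfectGraph G :=
    fun P h => perfect_of_star (star_of_reflexive P G h)
  refine ⟨⟨fun h P => reflexive_of_star (star_of_perfect h) P, fun h => hR inferInstance (h _)⟩,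
    ⟨fun h => ⟨inferInstance, reflexive_of_star (star_of_perfect h) _⟩, fun ⟨P, h⟩ => hR P h⟩⟩

end HibiTsuchiya
end

section
/- Let Δ be a simplicial complex on [d] = {1,...,d} that is not flag, i.e., Δ has a minimal nonface L with |L| ≥ 3. Then for every finite partially ordered set P on [d], the polytope Γ(O_P, P_Δ) = conv(O_P ∪ (−P_Δ)) is not reflexive. -/
open scoped Pointwise

namespace HibiTsuchiya

/-- If a simplicial complex `Δ` on `[d]` is not flag, i.e. has a minimal nonface `L` with
`|L| ≥ 3`, then `Γ(O_P, P_Δ)` is not reflexive for any poset `P` on `[d]`. -/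
theorem gamma_not_reflexive_of_not_flag (d : ℕ) (Δ : Set (Finset (Fin d)))
    (hΔ : IsSimplicialComplex Δ) (L : Finset (Fin d)) (hcard : 3 ≤ L.card)
    (hLnot : L ∉ Δ) (hLmin : ∀ L' ⊂ L, L' ∈ Δ) (P : PartialOrder (Fin d)) :
    ¬ IsReflexive (gammaPolytope (orderPolytope P) (complexPolytope Δ)) := by
  rintro ⟨-, V, hV, hD⟩
  have hc : (3 : ℝ) ≤ (L.card : ℝ) := by exact_mod_cast hcard
  -- every lattice point of the dual satisfies `v(L) ≥ -1`
  have hhalf : Convex ℝ {x : Fin d → ℝ | -1 ≤ ∑ i ∈ L, x i} := by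
    intro x hx y hy a b ha hb hab
    simp only [Set.mem_setOf_eq, Pi.add_apply, Pi.smul_apply, smul_eq_mul,
      Finset.sum_add_distrib, ← Finset.mul_sum] at *
    nlinarith
  have hVL : (V : Set (Fin d → ℝ)) ⊆ {x : Fin d → ℝ | -1 ≤ ∑ i ∈ L, x i} := by
    intro v hv
    have hvD : v ∈ dualPolytope (gammaPolytope (orderPolytope P) (complexPolytope Δ)) := by
      rw [hD]; exact subset_convexHull ℝ _ hv
    have h1 : ∀ i ∈ L, -1 ≤ ∑ j ∈ L, v j - v i := by
      intro i hi
      have hF : L.erase i ∈ Δ := hLmin _ (Finset.erase_ssubset hi)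
      have hy : -(indicator (↑(L.erase i) : Set (Fin d))) ∈
          gammaPolytope (orderPolytope P) (complexPolytope Δ) := by
        apply subset_convexHull
        right
        rw [Set.mem_neg, neg_neg]
        exact subset_convexHull ℝ _ ⟨_, hF, rfl⟩
      have h := hvD _ hy
      have he : ∑ j, v j * (-(indicator (↑(L.erase i) : Set (Fin d)))) j
          = -∑ j ∈ L.erase i, v j := by
        simp only [indicator, Pi.neg_apply, Set.indicator_apply, Finset.mem_coe, mul_neg,
          mul_ite, mul_one, mul_zero, Finset.sum_neg_distrib, Finset.sum_ite_mem,
          Finset.univ_inter]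
      rw [he] at h
      have := Finset.add_sum_erase L v hi
      linarith
    have h2 := Finset.sum_le_sum h1
    simp only [Finset.sum_const, Finset.sum_sub_distrib, nsmul_eq_mul] at h2
    choose z hz using hV v hv
    have hs : ∑ i ∈ L, v i = ((∑ i ∈ L, z i : ℤ) : ℝ) := by
      push_cast
      exact Finset.sum_congr rfl fun i _ => hz i
    rw [Set.mem_setOf_eq]
    rw [hs] at h2 ⊢
    by_contra hlt
    have hlt' : (∑ i ∈ L, z i) ≤ -2 := by
      by_contra hh
      have : -1 ≤ ∑ i ∈ L, z i := by omega
      exact hlt (by exact_mod_cast this)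
    have hlt2 : ((∑ i ∈ L, z i : ℤ) : ℝ) ≤ -2 := by exact_mod_cast hlt'
    nlinarith
  -- the witness
  set c : ℝ := 1 / ((L.card : ℝ) - 1) with hcdef
  have hcpos : 0 < c := by apply one_div_pos.mpr; linarith
  have hcmul : c * ((L.card : ℝ) - 1) = 1 := by
    rw [hcdef]; apply one_div_mul_cancel; linarith
  let w : Fin d → ℝ := fun i => if i ∈ L then -c else 0
  have hwsum : ∀ S : Set (Fin d), ∑ i, w i * indicator S i = ∑ i ∈ L, -c * indicator S i := by
    intro S
    simp only [w, ite_mul, zero_mul, Finset.sum_ite_mem, Finset.univ_inter]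
  have hle : Convex ℝ {y : Fin d → ℝ | ∑ i, w i * y i ≤ 1} := by
    intro x hx y hy a b ha hb hab
    simp only [Set.mem_setOf_eq, Pi.add_apply, Pi.smul_apply, smul_eq_mul] at *
    have : ∑ i, w i * (a * x i + b * y i) = a * ∑ i, w i * x i + b * ∑ i, w i * y i := by
      rw [Finset.mul_sum, Finset.mul_sum, ← Finset.sum_add_distrib]
      exact Finset.sum_congr rfl fun i _ => by ring
    rw [this]
    nlinarith
  have hge : Convex ℝ {y : Fin d → ℝ | -1 ≤ ∑ i, w i * y i} := by
    intro x hx y hy a b ha hb hab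
    simp only [Set.mem_setOf_eq, Pi.add_apply, Pi.smul_apply, smul_eq_mul] at *
    have : ∑ i, w i * (a * x i + b * y i) = a * ∑ i, w i * x i + b * ∑ i, w i * y i := by
      rw [Finset.mul_sum, Finset.mul_sum, ← Finset.sum_add_distrib]
      exact Finset.sum_congr rfl fun i _ => by ring
    rw [this]
    nlinarith
  have hwD : w ∈ dualPolytope (gammaPolytope (orderPolytope P) (complexPolytope Δ)) := by
    have key : gammaPolytope (orderPolytope P) (complexPolytope Δ) ⊆
        {y : Fin d → ℝ | ∑ i, w i * y i ≤ 1} := by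
      apply convexHull_min _ hle
      apply Set.union_subset
      · apply convexHull_min _ hle
        rintro _ ⟨I, -, rfl⟩
        rw [Set.mem_setOf_eq, hwsum]
        refine le_trans (Finset.sum_nonpos fun i _ => ?_) zero_le_one
        have : 0 ≤ indicator I i := Set.indicator_nonneg (fun _ _ => zero_le_one) i
        nlinarith
      · have hsub : complexPolytope Δ ⊆ {y : Fin d → ℝ | -1 ≤ ∑ i, w i * y i} := by
          apply convexHull_min _ hge
          rintro _ ⟨F, hF, rfl⟩
          rw [Set.mem_setOf_eq, hwsum, ← Finset.mul_sum]
          have hsum : ∑ i ∈ L, indicator (↑F : Set (Fin d)) i = ((L ∩ F).card : ℝ) := by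
            simp only [indicator, Set.indicator_apply, Finset.mem_coe, Finset.sum_ite_mem,
              Finset.sum_const, nsmul_eq_mul, mul_one]
          have hcardlt : (L ∩ F).card < L.card := by
            apply Finset.card_lt_card
            refine ⟨Finset.inter_subset_left, fun h => hLnot (hΔ.2 F hF L ?_)⟩
            exact h.trans Finset.inter_subset_right
          have hcl : ((L ∩ F).card : ℝ) + 1 ≤ (L.card : ℝ) := by exact_mod_cast hcardlt
          rw [hsum]
          nlinarith
        intro y hy
        have h := hsub (Set.mem_neg.mp hy)
        simp only [Set.mem_setOf_eq, Pi.neg_apply, mul_neg, Finset.sum_neg_distrib] at h ⊢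
        linarith
    intro y hy
    exact key hy
  rw [hD] at hwD
  have hfin := convexHull_min hVL hhalf hwD
  have hw : ∑ i ∈ L, w i = -((L.card : ℝ) * c) := by
    rw [Finset.sum_congr rfl (fun i hi => if_pos hi : ∀ i ∈ L, w i = -c)]
    simp
  rw [Set.mem_setOf_eq, hw] at hfin
  nlinarith

end HibiTsuchiya
end

section
/- Let G be a finite simple graph on [d] = {1,...,d} that has an odd antihole, i.e., an induced subgraph whose complement is an odd cycle of length ≥ 5. Then for every finite partially ordered set P on [d], the polytope Γ(O_P, Q_G) = conv(O_P ∪ (−Q_G)) is not reflexive. -/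
open scoped Pointwise

namespace HibiTsuchiya

/-- The adjacency relation of the cycle of length `m` on `ZMod m`. -/
def cycleAdj (m : ℕ) (i j : ZMod m) : Prop := i ≠ j ∧ (j = i + 1 ∨ i = j + 1)

/-- `G` has an *odd hole*: an induced odd cycle of length `2ℓ+1 ≥ 5`. -/
def HasOddHole {n : ℕ} (G : SimpleGraph (Fin n)) : Prop :=
  ∃ ℓ : ℕ, 2 ≤ ℓ ∧ ∃ f : ZMod (2 * ℓ + 1) → Fin n, Function.Injective f ∧
    ∀ i j, G.Adj (f i) (f j) ↔ cycleAdj (2 * ℓ + 1) i j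

/-- `G` has an *odd antihole*: an induced subgraph whose complement is an odd cycle of
length `2ℓ+1 ≥ 5`. -/
def HasOddAntihole {n : ℕ} (G : SimpleGraph (Fin n)) : Prop :=
  ∃ ℓ : ℕ, 2 ≤ ℓ ∧ ∃ f : ZMod (2 * ℓ + 1) → Fin n, Function.Injective f ∧
    ∀ i j, G.Adj (f i) (f j) ↔ (i ≠ j ∧ ¬ cycleAdj (2 * ℓ + 1) i j)

lemma three_stable {l : ℕ} (hl : 2 ≤ l) (a b c : ZMod (2 * l + 1))
    (hab : cycleAdj (2 * l + 1) a b) (hac : cycleAdj (2 * l + 1) a c)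
    (hbc : cycleAdj (2 * l + 1) b c) : False := by
  have h1 : (1 : ZMod (2 * l + 1)) ≠ 0 := by
    intro h
    have h' : ((1 : ℕ) : ZMod (2 * l + 1)) = 0 := by exact_mod_cast h
    rw [ZMod.natCast_eq_zero_iff] at h'
    have := Nat.le_of_dvd (by norm_num) h'
    omega
  have h3 : (3 : ZMod (2 * l + 1)) ≠ 0 := by
    intro h
    have h' : ((3 : ℕ) : ZMod (2 * l + 1)) = 0 := by exact_mod_cast h
    rw [ZMod.natCast_eq_zero_iff] at h'
    have := Nat.le_of_dvd (by norm_num) h'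
    omega
  obtain ⟨n1, h1'⟩ := hab
  obtain ⟨n2, h2'⟩ := hac
  obtain ⟨n3, h3'⟩ := hbc
  rcases h1' with h | h <;> rcases h2' with h' | h' <;> rcases h3' with h'' | h'' <;>
    first
      | exact n3 (by linear_combination h - h')
      | exact n1 (by linear_combination h' - h'')
      | exact n1 (by linear_combination h' + h'')
      | exact n2 (by linear_combination h + h'')
      | exact n2 (by linear_combination h - h'')
      | exact n3 (by linear_combination h' - h)
      | exact h1 (by linear_combination h - h' + h'')
      | exact h1 (by linear_combination -h + h' - h'')
      | exact h1 (by linear_combination h - h' - h'')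
      | exact h1 (by linear_combination h' - h + h'')
      | exact h3 (by linear_combination -h - h' - h'')

lemma pair_halfspace {n : ℕ} (x : Fin n → ℝ) (c : ℝ) :
    Convex ℝ {y : Fin n → ℝ | ∑ i, x i * y i ≤ c} := by
  apply convex_halfSpace_le
  constructor
  · intro a b; simp [mul_add, Finset.sum_add_distrib]
  · intro r a; simp only [Pi.smul_apply, smul_eq_mul, Finset.mul_sum]
    exact Finset.sum_congr rfl fun _ _ => by ring

/-- If a finite simple graph `G` on `[d]` has an odd antihole, then `Γ(O_P, Q_G)` is not
reflexive for any poset `P` on `[d]`. -/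
theorem gamma_not_reflexive_of_oddAntihole (d : ℕ) (G : SimpleGraph (Fin d))
    (hG : HasOddAntihole G) (P : PartialOrder (Fin d)) :
    ¬ IsReflexive (gammaPolytope (orderPolytope P) (stableSetPolytope G)) := by
  rintro ⟨-, V, hV, hD⟩
  obtain ⟨l, hl, f, hf, hadj⟩ := hG
  classical
  let x : Fin d → ℝ := fun i => -∑ k, if f k = i then (1 / 2 : ℝ) else 0
  have hx : ∀ y : Fin d → ℝ, ∑ i, x i * y i = -(1 / 2) * ∑ k, y (f k) := by
    intro y
    simp only [x, neg_mul, Finset.sum_mul, Finset.sum_neg_distrib, ite_mul, zero_mul]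
    rw [Finset.sum_comm]
    simp [Finset.mul_sum]
  -- the half-integral point lies in the dual polytope
  have hxD : x ∈ dualPolytope (gammaPolytope (orderPolytope P) (stableSetPolytope G)) := by
    have key : gammaPolytope (orderPolytope P) (stableSetPolytope G) ⊆
        {y : Fin d → ℝ | ∑ i, x i * y i ≤ 1} := by
      refine convexHull_min (Set.union_subset ?_ ?_) (pair_halfspace x 1)
      · refine convexHull_min ?_ (pair_halfspace x 1)
        rintro y ⟨I, -, rfl⟩
        rw [Set.mem_ofPred_eq, hx]
        have : 0 ≤ ∑ k, indicator I (f k) :=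
          Finset.sum_nonneg fun k _ => Set.indicator_nonneg (fun _ _ => zero_le_one) _
        linarith
      · have h2 : stableSetPolytope G ⊆ {y : Fin d → ℝ | ∑ i, (-x) i * y i ≤ 1} := by
          refine convexHull_min ?_ (pair_halfspace (-x) 1)
          rintro y ⟨S, hS, rfl⟩
          simp only [Set.mem_ofPred_eq, Pi.neg_apply, neg_mul, Finset.sum_neg_distrib]
          rw [hx]
          have hc : (Finset.univ.filter fun k => f k ∈ S).card ≤ 2 := by
            by_contra hc
            push Not at hc
            obtain ⟨a, ha, b, hb, c, hc, hab, hac, hbc⟩ := Finset.two_lt_card.1 hc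
            simp only [Finset.mem_filter, Finset.mem_univ, true_and] at ha hb hc
            have st : ∀ a b, f a ∈ S → f b ∈ S → a ≠ b → cycleAdj (2 * l + 1) a b := by
              intro a b ha hb hab
              by_contra hn
              exact hS _ ha _ hb ((hadj a b).2 ⟨hab, hn⟩)
            exact three_stable hl a b c (st a b ha hb hab) (st a c ha hc hac) (st b c hb hc hbc)
          have hs : ∑ k, indicator S (f k) = ((Finset.univ.filter fun k => f k ∈ S).card : ℝ) := by
            simp [indicator, Set.indicator_apply]
          rw [hs]
          have : ((Finset.univ.filter fun k => f k ∈ S).card : ℝ) ≤ 2 := by exact_mod_cast hc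
          linarith
        intro y hy
        have := h2 (Set.mem_neg.1 hy)
        simpa using this
    exact fun y hy => key hy
  -- lattice points of the dual satisfy a stronger inequality
  have hVs : (V : Set (Fin d → ℝ)) ⊆
      {y : Fin d → ℝ | ∑ i, x i * y i ≤ (l : ℝ) / 2} := by
    intro v hv
    rw [Set.mem_ofPred_eq, hx]
    have hvD : v ∈ dualPolytope (gammaPolytope (orderPolytope P) (stableSetPolytope G)) := by
      rw [hD]; exact subset_convexHull ℝ _ hv
    have hedge : ∀ k, -1 ≤ v (f k) + v (f (k + 1)) := by
      intro k
      have hne : k ≠ k + 1 := by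
        intro h
        have h0 : (1 : ZMod (2 * l + 1)) = 0 := by linear_combination -h
        have h' : ((1 : ℕ) : ZMod (2 * l + 1)) = 0 := by exact_mod_cast h0
        rw [ZMod.natCast_eq_zero_iff] at h'
        have := Nat.le_of_dvd (by norm_num) h'
        omega
      have hst : IsStableSet G {f k, f (k + 1)} := by
        rintro i (rfl | rfl) j (rfl | rfl) <;> rw [hadj]
        · simp
        · rintro ⟨h, h'⟩; exact h' ⟨h, Or.inl rfl⟩
        · rintro ⟨h, h'⟩; exact h' ⟨h, Or.inr rfl⟩
        · simp
      have hm : -indicator {f k, f (k + 1)} ∈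
          gammaPolytope (orderPolytope P) (stableSetPolytope G) := by
        refine subset_convexHull ℝ _ (Or.inr ?_)
        rw [Set.mem_neg, neg_neg]
        exact subset_convexHull ℝ _ ⟨_, hst, rfl⟩
      have h := hvD _ hm
      have hfn : f k ≠ f (k + 1) := fun h => hne (hf h)
      have hs : ∑ i, v i * (-indicator {f k, f (k + 1)}) i = -(v (f k) + v (f (k + 1))) := by
        rw [← Finset.sum_pair hfn, ← Finset.sum_neg_distrib]
        symm
        apply Finset.sum_subset_zero_on_sdiff (Finset.subset_univ _)
        · intro i hi
          have : i ∉ ({f k, f (k + 1)} : Set (Fin d)) := by simpa using hi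
          simp [indicator, this]
        · intro i hi
          have : i ∈ ({f k, f (k + 1)} : Set (Fin d)) := by simpa using hi
          simp only [Pi.neg_apply, indicator, Set.indicator_of_mem this]; ring
      linarith
    choose z hz using hV v hv
    have hsum : -(2 * l + 1 : ℝ) ≤ 2 * ∑ k, v (f k) := by
      have h1 := Finset.sum_le_sum fun k (_ : k ∈ (Finset.univ : Finset (ZMod (2 * l + 1)))) =>
        hedge k
      rw [Finset.sum_add_distrib,
        show ∑ k, v (f (k + 1)) = ∑ k, v (f k) from
          Equiv.sum_comp (Equiv.addRight (1 : ZMod (2 * l + 1))) (fun k => v (f k))] at h1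
      simp only [Finset.sum_const, Finset.card_univ, ZMod.card, nsmul_eq_mul] at h1
      push_cast at h1
      linarith
    simp only [hz] at hsum ⊢
    have hzi : -(2 * (l : ℤ) + 1) ≤ 2 * ∑ k, z (f k) := by exact_mod_cast hsum
    have hzi' : -(l : ℤ) ≤ ∑ k, z (f k) := by omega
    have : -(l : ℝ) ≤ ∑ k, (z (f k) : ℝ) := by exact_mod_cast hzi'
    linarith
  rw [hD] at hxD
  have hfin := convexHull_min hVs (pair_halfspace x _) hxD
  rw [Set.mem_ofPred_eq, hx] at hfin
  have hxf : ∀ k, x (f k) = -(1 / 2) := by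
    intro k
    simp [x, hf.eq_iff]
  simp only [hxf, Finset.sum_const, Finset.card_univ, ZMod.card, nsmul_eq_mul] at hfin
  push_cast at hfin
  linarith

end HibiTsuchiya
end
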